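/- (Column-bumping bijection) Fix integers m ≥ 1 and ℓ ≥ 1 and a partition λ. Let A be the set of pairs (C,T) where C is a set-valued tableau of the one-column shape (1^ℓ) and T is a set-valued tableau of shape λ, both with entries in {1,…,m}. Let B be the set of pairs (T′,S) where T′ is a set-valued tableau with entries in {1,…,m} whose shape is a partition ν ⊇ λ such that ν/λ is a vertical strip with |ν/λ| ≥ ℓ, and S is a set of indices of nonempty columns of ν/λ which does not contain the index of the rightmost nonempty column of ν/λ and has cardinality |ν/λ| − ℓ. Then there exists a bijection from A to B such that whenever (C,T) maps to (T′,S), one has x^C·x^T = x^{T′}. -/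

import Mathlib

open MvPolynomial

/-- A set-valued tableau on an arbitrary finite set of boxes `(row, column)`.
Entries are `0`-based: the entry `i : ℕ` stands for the integer `i + 1`
(equivalently, for the variable `x_{i+1}`).  Rows weakly increase from left to
right and columns strictly increase from top to bottom, expressed via
horizontally and vertically adjacent boxes. -/
structure SVT (cells : Finset (ℕ × ℕ)) where
  entry : ℕ × ℕ → Finset ℕ
  nonempty_of_mem : ∀ c ∈ cells, (entry c).Nonempty
  eq_empty_of_not_mem : ∀ c, c ∉ cells → entry c = ∅
  row_weak : ∀ i j, (i, j) ∈ cells → (i, j + 1) ∈ cells →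
    ∀ a ∈ entry (i, j), ∀ b ∈ entry (i, j + 1), a ≤ b
  col_strict : ∀ i j, (i, j) ∈ cells → (i + 1, j) ∈ cells →
    ∀ a ∈ entry (i, j), ∀ b ∈ entry (i + 1, j), a < b

namespace SVT

variable {cells : Finset (ℕ × ℕ)}

/-- `|T|`: the total number of integers in the boxes of `T`. -/
def size (T : SVT cells) : ℕ := ∑ c ∈ cells, (T.entry c).card

/-- `T` has all its entries among `{1, …, m}` (i.e. `0`-based entries `< m`). -/
def Bounded (T : SVT cells) (m : ℕ) : Prop := ∀ c, ∀ x ∈ T.entry c, x < m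

/-- The monomial `x^T`, where the exponent of the variable `i` is the number of
boxes of `T` containing `i`. -/
noncomputable def monomial (T : SVT cells) : MvPolynomial ℕ ℤ :=
  ∏ c ∈ cells, ∏ i ∈ T.entry c, X i

/-- The column word of `T`: columns are read from left to right, each column
from bottom to top, the integers within a box in increasing order. -/
def word (T : SVT cells) : List ℕ :=
  (List.range ((cells.sup fun c => max c.1 c.2) + 1)).flatMap fun j =>
    ((List.range ((cells.sup fun c => max c.1 c.2) + 1)).reverse).flatMap fun i =>
      (T.entry (i, j)).sort (· ≤ ·)

end SVT

/-- The stable Grothendieck polynomial of the shape given by `cells`, in the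
variables `x_1, …, x_m` (`0`-based: variables `0, …, m-1`):
`G(cells) = ∑_T (-1)^(|T| - #cells) x^T` over set-valued tableaux `T` of shape
`cells` with entries in `{1, …, m}`. -/
noncomputable def grothendieck (cells : Finset (ℕ × ℕ)) (m : ℕ) : MvPolynomial ℕ ℤ :=
  ∑ᶠ (T : SVT cells) (_ : T.Bounded m), ((-1 : ℤ) ^ (T.size - cells.card)) • T.monomial

/-- A reverse lattice word: every suffix contains, for each `i`, at least as
many occurrences of `i` as of `i + 1`. -/
def IsRLW (w : List ℕ) : Prop := ∀ s, s <:+ w → ∀ i, s.count (i + 1) ≤ s.count i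

/-- A partial reverse lattice word with respect to the (`0`-based, half-open)
interval `[a, b)`:  every suffix contains, for each `t` with `a ≤ t` and
`t + 1 < b`, at least as many occurrences of `t` as of `t + 1`. -/
def IsPartialRLW (a b : ℕ) (w : List ℕ) : Prop :=
  ∀ s, s <:+ w → ∀ t, a ≤ t → t + 1 < b → s.count (t + 1) ≤ s.count t

/-- `w` has content `ν`: the number of occurrences of `i` in `w` is the length
of the `i`-th row of `ν`. -/
def HasContent (w : List ℕ) (nu : YoungDiagram) : Prop := ∀ i, w.count i = nu.rowLen i

/-- The cells of the skew diagram `λ * μ`, obtained by placing `λ` and `μ`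
corner to corner: `λ` occupies rows `0, …, ℓ(λ)-1` shifted right by `μ₁`
columns, and `μ` occupies the rows below row `ℓ(λ)-1`. -/
def starCells (lam mu : YoungDiagram) : Finset (ℕ × ℕ) :=
  (lam.cells.image fun c => (c.1, c.2 + mu.rowLen 0)) ∪
    (mu.cells.image fun c => (c.1 + lam.colLen 0, c.2))

/-- The structure constant `c^ν_{λμ}`: `(-1)^(|ν|-|λ|-|μ|)` times the number of
set-valued tableaux of shape `λ * μ` whose word is a reverse lattice word with
content `ν`. -/
noncomputable def cLR (lam mu nu : YoungDiagram) : ℤ :=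
  (-1 : ℤ) ^ (nu.card - lam.card - mu.card) *
    (Nat.card {T : SVT (starCells lam mu) // IsRLW T.word ∧ HasContent T.word nu} : ℤ)

/-- The coproduct structure constant `d^ν_{λμ}`: `(-1)^(|λ|+|μ|-|ν|)` times the
number of set-valued tableaux of shape `ν` whose word is a partial reverse
lattice word with respect to both intervals `[1, ℓ(λ)]` and
`[ℓ(λ)+1, ℓ(λ)+ℓ(μ)]` and has content `(λ₁, …, λ_{ℓ(λ)}, μ₁, …, μ_{ℓ(μ)})`. -/
noncomputable def dCoeff (lam mu nu : YoungDiagram) : ℤ :=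
  (-1 : ℤ) ^ (lam.card + mu.card - nu.card) *
    (Nat.card {T : SVT nu.cells //
      IsPartialRLW 0 (lam.colLen 0) T.word ∧
      IsPartialRLW (lam.colLen 0) (lam.colLen 0 + mu.colLen 0) T.word ∧
      ∀ i, T.word.count i =
        if i < lam.colLen 0 then lam.rowLen i else mu.rowLen (i - lam.colLen 0)} : ℤ)

/-- The coefficient `α_{θ,μ}` for a shape `θ` given by `cells`:
`(-1)^(|μ|-|θ|)` times the number of set-valued tableaux of shape `θ` whose
word is a reverse lattice word with content `μ`. -/
noncomputable def alphaCoeff (cells : Finset (ℕ × ℕ)) (mu : YoungDiagram) : ℤ :=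
  (-1 : ℤ) ^ (mu.card - cells.card) *
    (Nat.card {T : SVT cells // IsRLW T.word ∧ HasContent T.word mu} : ℤ)

/-- `ν/λ` is a vertical strip: at most one box in each row. -/
def IsVerticalStrip (lam nu : YoungDiagram) : Prop := ∀ i, nu.rowLen i ≤ lam.rowLen i + 1

/-- `ν/λ` is a horizontal strip: at most one box in each column. -/
def IsHorizontalStrip (lam nu : YoungDiagram) : Prop := ∀ j, nu.colLen j ≤ lam.colLen j + 1

/-- A set of boxes is a rook strip if it has at most one box in each row and in
each column. -/
def IsRookStripCells (s : Finset (ℕ × ℕ)) : Prop :=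
  (∀ i, (s.filter fun c => c.1 = i).card ≤ 1) ∧ (∀ j, (s.filter fun c => c.2 = j).card ≤ 1)

/-- The rectangular Young diagram with `p` rows and `q` columns. -/
def rect (p q : ℕ) : YoungDiagram :=
  ⟨Finset.range p ×ˢ Finset.range q, by
    intro a b hba ha
    simp only [Finset.coe_product, Set.mem_prod, Finset.mem_coe, Finset.mem_range] at ha ⊢
    exact ⟨lt_of_le_of_lt hba.1 ha.1, lt_of_le_of_lt hba.2 ha.2⟩⟩

/-! ### A one-variable transfer-matrix identity -/

section Transfer

variable {R : Type*} [CommRing R]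

/-- Transfer-matrix recursion along the rows. -/
def transferVec (f₀ : Bool → R) (f : ℕ → Bool → Bool → R) : ℕ → Bool → R
  | 0, b => f₀ b
  | k + 1, b => transferVec f₀ f k false * f k false b + transferVec f₀ f k true * f k true b

lemma sum_powerset_eq_transferVec (f₀ : Bool → R) (f : ℕ → Bool → Bool → R) (k : ℕ)
    (g : Bool → R) :
    ∑ A ∈ (Finset.range (k + 1)).powerset, f₀ (decide (0 ∈ A)) *
        (∏ i ∈ Finset.range k, f i (decide (i ∈ A)) (decide (i + 1 ∈ A))) * g (decide (k ∈ A)) =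
      transferVec f₀ f k false * g false + transferVec f₀ f k true * g true := by
  induction k generalizing g with
  | zero =>
    rw [Finset.range_add_one, Finset.sum_powerset_insert (by simp)]
    simp [transferVec]
  | succ k ih =>
    rw [Finset.range_add_one, Finset.sum_powerset_insert (by simp), ← Finset.sum_add_distrib]
    have h := ih (fun b => f k b false * g false + f k b true * g true)
    rw [show transferVec f₀ f (k + 1) false * g false + transferVec f₀ f (k + 1) true * g true =
      transferVec f₀ f k false * (f k false false * g false + f k false true * g true) +
      transferVec f₀ f k true * (f k true false * g false + f k true true * g true) by
        simp only [transferVec]; ring, ← h]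
    refine Finset.sum_congr rfl fun A hA => ?_
    have hk : k + 1 ∉ A := fun h => by
      have := Finset.mem_powerset.1 hA h
      simp at this
    have hprod : ∏ i ∈ Finset.range k, f i (decide (i ∈ insert (k + 1) A))
        (decide (i + 1 ∈ insert (k + 1) A)) =
        ∏ i ∈ Finset.range k, f i (decide (i ∈ A)) (decide (i + 1 ∈ A)) := by
      refine Finset.prod_congr rfl fun i hi => ?_
      have : i < k := Finset.mem_range.1 hi
      have h1 : i ≠ k + 1 := by omega
      have h2 : i + 1 ≠ k + 1 := by omega
      simp only [Finset.mem_insert, h1, h2, false_or]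
    rw [Finset.prod_range_succ, Finset.prod_range_succ, hprod]
    simp [hk]
    ring

/-- The factor of a horizontal strip contributed by the end of a row: `a` is the outer row,
`c` the inner row. -/
def rowWt (x : R) (a c : ℤ) : R := if c ≤ a then x ^ (a - c).toNat else 0

/-- The factor contributed by the last box of the inner row `c` lying above the outer row `b`. -/
def cornerWt (x : R) (b c : ℤ) : R := if b ≤ c then (if b < c then 1 + x else 1) else 0

/-- The factor of a vertical strip contributed by a row growing from `a` to `n`, where `p` is the
inner row above. -/
def boxWt (t : R) (p a n : ℤ) : R :=
  if n = a then 1 else if n = a + 1 then (if a < p then 1 + t else t) else 0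

/-- The row above row `i`, with a virtual longer row above the first. -/
def rowAbove (lam : ℕ → ℤ) : ℕ → ℤ
  | 0 => lam 0 + 1
  | i + 1 => lam i

/-- The one-variable branching weight. -/
def branchWt (N : ℕ) (x : R) (lam mu : ℕ → ℤ) : R :=
  ∏ i ∈ Finset.range N, rowWt x (lam i) (mu i) * cornerWt x (lam (i + 1)) (mu i)

/-- The vertical strip weight. -/
def stripWt (N : ℕ) (t : R) (nu lam : ℕ → ℤ) : R :=
  ∏ i ∈ Finset.range N, boxWt t (rowAbove lam i) (lam i) (nu i)

/-- A Boolean as an integer, `0` or `1`. -/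
def bit (b : Bool) : ℤ := if b then 1 else 0

lemma sum_branchWt_mul_stripWt (n : ℕ) (t x : R) (lam kap : ℕ → ℤ) :
    ∑ A ∈ (Finset.range (n + 1)).powerset,
      branchWt (n + 1) x lam (fun i => kap i - bit (decide (i ∈ A))) *
        stripWt (n + 1) t kap (fun i => kap i - bit (decide (i ∈ A))) =
    ∑ b : Bool, transferVec
      (fun b => rowWt x (lam 0) (kap 0 - bit b) *
        boxWt t (kap 0 - bit b + 1) (kap 0 - bit b) (kap 0))
      (fun i b c => cornerWt x (lam (i + 1)) (kap i - bit b) *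
        (rowWt x (lam (i + 1)) (kap (i + 1) - bit c) *
          boxWt t (kap i - bit b) (kap (i + 1) - bit c) (kap (i + 1)))) n b *
      cornerWt x (lam (n + 1)) (kap n - bit b) := by
  rw [Fintype.sum_bool, add_comm (transferVec _ _ _ _ * _), ← sum_powerset_eq_transferVec _ _ n
    (fun b => cornerWt x (lam (n + 1)) (kap n - bit b))]
  refine Finset.sum_congr rfl fun A _ => ?_
  simp only [branchWt, stripWt, ← Finset.prod_mul_distrib]
  rw [Finset.prod_congr rfl fun i _ => show _ =
    (rowWt x (lam i) (kap i - bit (decide (i ∈ A))) *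
      boxWt t (rowAbove (fun i => kap i - bit (decide (i ∈ A))) i)
        (kap i - bit (decide (i ∈ A))) (kap i)) *
      cornerWt x (lam (i + 1)) (kap i - bit (decide (i ∈ A))) by ring,
    Finset.prod_mul_distrib, Finset.prod_range_succ', Finset.prod_range_succ]
  simp only [Finset.prod_mul_distrib, rowAbove]
  ring

lemma sum_stripWt_mul_branchWt (n : ℕ) (t x : R) (lam kap : ℕ → ℤ) :
    ∑ A ∈ (Finset.range (n + 1)).powerset,
      stripWt (n + 1) t (fun i => lam i + bit (decide (i ∈ A))) lam *
        branchWt (n + 1) x (fun i => lam i + bit (decide (i ∈ A))) kap =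
    ∑ b : Bool, transferVec
      (fun b => rowWt x (lam 0 + bit b) (kap 0) * boxWt t (lam 0 + 1) (lam 0) (lam 0 + bit b))
      (fun i _ c => cornerWt x (lam (i + 1) + bit c) (kap i) *
        (rowWt x (lam (i + 1) + bit c) (kap (i + 1)) *
          boxWt t (lam i) (lam (i + 1)) (lam (i + 1) + bit c))) n b *
      cornerWt x (lam (n + 1)) (kap n) := by
  rw [Fintype.sum_bool, add_comm (transferVec _ _ _ _ * _), ← sum_powerset_eq_transferVec _ _ n
    (fun b => cornerWt x (lam (n + 1)) (kap n))]
  refine Finset.sum_congr rfl fun A hA => ?_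
  have hA' : n + 1 ∉ A := fun h => by
    have := Finset.mem_powerset.1 hA h
    simp at this
  simp only [branchWt, stripWt, ← Finset.prod_mul_distrib]
  rw [Finset.prod_congr rfl fun i _ => show _ =
    (rowWt x (lam i + bit (decide (i ∈ A))) (kap i) *
      boxWt t (rowAbove lam i) (lam i) (lam i + bit (decide (i ∈ A)))) *
      cornerWt x (lam (i + 1) + bit (decide (i + 1 ∈ A))) (kap i) by ring,
    Finset.prod_mul_distrib, Finset.prod_range_succ', Finset.prod_range_succ]
  simp only [Finset.prod_mul_distrib, rowAbove, hA']
  simp [bit]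
  ring

lemma boxWt_self (t : R) (p a : ℤ) : boxWt t p a a = 1 := by simp [boxWt]

lemma boxWt_add_one (t : R) (p a : ℤ) :
    boxWt t p a (a + 1) = if a < p then 1 + t else t := by simp [boxWt]

lemma boxWt_sub_one (t : R) (p a : ℤ) :
    boxWt t p (a - 1) a = if a - 1 < p then 1 + t else t := by
  simpa using boxWt_add_one t p (a - 1)

lemma transferStep_invariant (t x : R) {v0 v1 w0 w1 : R} {a b c d : ℤ}
    (i1 : v0 + v1 = w0 + w1) (i2 : c ≤ a → v0 + v1 = (1 + (1 + t) * x) * v0)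
    (i3 : a < c → v0 = 0 ∧ w0 = 0) (i4 : a + 1 < c → v1 = 0) (hl : b ≤ a) (hk : d ≤ c) :
    v0 * (cornerWt x b c * (rowWt x b d * boxWt t c d d)) +
          v1 * (cornerWt x b (c - 1) * (rowWt x b d * boxWt t (c - 1) d d)) +
        (v0 * (cornerWt x b c * (rowWt x b (d - 1) * boxWt t c (d - 1) d)) +
          v1 * (cornerWt x b (c - 1) * (rowWt x b (d - 1) * boxWt t (c - 1) (d - 1) d))) =
      w0 * (cornerWt x b c * (rowWt x b d * boxWt t a b b)) +
          w1 * (cornerWt x b c * (rowWt x b d * boxWt t a b b)) +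
        (w0 * (cornerWt x (b + 1) c * (rowWt x (b + 1) d * boxWt t a b (b + 1))) +
          w1 * (cornerWt x (b + 1) c * (rowWt x (b + 1) d * boxWt t a b (b + 1)))) ∧
    (d ≤ b →
        v0 * (cornerWt x b c * (rowWt x b d * boxWt t c d d)) +
              v1 * (cornerWt x b (c - 1) * (rowWt x b d * boxWt t (c - 1) d d)) +
            (v0 * (cornerWt x b c * (rowWt x b (d - 1) * boxWt t c (d - 1) d)) +
              v1 * (cornerWt x b (c - 1) * (rowWt x b (d - 1) * boxWt t (c - 1) (d - 1) d))) =
          (1 + (1 + t) * x) *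
            (v0 * (cornerWt x b c * (rowWt x b d * boxWt t c d d)) +
              v1 * (cornerWt x b (c - 1) * (rowWt x b d * boxWt t (c - 1) d d)))) ∧
      (b < d →
        v0 * (cornerWt x b c * (rowWt x b d * boxWt t c d d)) +
              v1 * (cornerWt x b (c - 1) * (rowWt x b d * boxWt t (c - 1) d d)) = 0 ∧
          w0 * (cornerWt x b c * (rowWt x b d * boxWt t a b b)) +
              w1 * (cornerWt x b c * (rowWt x b d * boxWt t a b b)) = 0) ∧
      (b + 1 < d →
        v0 * (cornerWt x b c * (rowWt x b (d - 1) * boxWt t c (d - 1) d)) +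
          v1 * (cornerWt x b (c - 1) * (rowWt x b (d - 1) * boxWt t (c - 1) (d - 1) d)) = 0) := by
  obtain rfl : w1 = v0 + v1 - w0 := by rw [i1]; ring
  simp only [boxWt_self, boxWt_add_one, boxWt_sub_one]
  rcases le_or_gt d b with hd | hd
  · have r1 : rowWt x b d = x ^ (b - d).toNat := by simp [rowWt, hd]
    have r2 : rowWt x b (d - 1) = x * x ^ (b - d).toNat := by
      rw [rowWt, if_pos (by omega), show (b - (d - 1)).toNat = (b - d).toNat + 1 by omega, pow_succ']
    have r3 : rowWt x (b + 1) d = x * x ^ (b - d).toNat := by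
      rw [rowWt, if_pos (by omega), show (b + 1 - d).toNat = (b - d).toNat + 1 by omega, pow_succ']
    rw [r1, r2, r3]
    generalize x ^ (b - d).toNat = X
    have hd' : ¬ b < d := by omega
    have hd'' : ¬ b + 1 < d := by omega
    simp only [hd, hd', hd'', true_imp_iff, false_imp_iff, and_true]
    rcases lt_trichotomy c b with hc | rfl | hc
    · have h1 : ¬ b ≤ c := by omega
      have h2 : ¬ b ≤ c - 1 := by omega
      have h3 : ¬ b + 1 ≤ c := by omega
      simp [cornerWt, h1, h2, h3]
    · have e := i2 hl
      obtain rfl : v1 = (1 + t) * x * v0 := by linear_combination e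
      have h5 : d - 1 < c := by omega
      simp [cornerWt, h5]
      constructor <;> ring
    · rcases eq_or_lt_of_le (show b + 1 ≤ c by omega) with rfl | hc'
      · have h5 : d - 1 < b + 1 := by omega
        have h6 : d - 1 < b := by omega
        rcases le_or_gt (b + 1) a with ha | ha
        · have e := i2 ha
          obtain rfl : v1 = (1 + t) * x * v0 := by linear_combination e
          have h7 : b < a := by omega
          simp [cornerWt, h5, h6, h7]
          constructor <;> ring
        · obtain ⟨rfl, rfl⟩ := i3 ha
          have h7 : ¬ b < a := by omega
          simp [cornerWt, h6, h7]
          constructor <;> ring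
      · have h1 : b ≤ c := by omega
        have h2 : b ≤ c - 1 := by omega
        have h3 : b < c - 1 := by omega
        have h4 : b + 1 ≤ c := by omega
        have h5 : d - 1 < c := by omega
        have h6 : d - 1 < c - 1 := by omega
        rcases hl.eq_or_lt with rfl | h7
        · obtain ⟨rfl, rfl⟩ := i3 hc
          obtain rfl := i4 hc'
          simp
        · simp only [cornerWt, h1, h2, h3, h4, h5, h6, h7, hc, hc', if_true]
          constructor <;> ring
  · have hd' : ¬ d ≤ b := by omega
    have r1 : rowWt x b d = 0 := by simp [rowWt, hd']
    rw [r1]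
    simp only [hd', hd, true_imp_iff, false_imp_iff, true_and]
    rcases eq_or_lt_of_le (show b + 1 ≤ d by omega) with rfl | hd2
    · have r2 : rowWt x b (b + 1 - 1) = 1 := by simp [rowWt]
      have r3 : rowWt x (b + 1) (b + 1) = 1 := by simp [rowWt]
      have h1 : b ≤ c := by omega
      have h2 : b ≤ c - 1 := by omega
      have h3 : b < c := by omega
      rw [r2, r3]
      rcases eq_or_lt_of_le hk with rfl | hc
      · rcases le_or_gt (b + 1) a with ha | ha
        · have e := i2 ha
          obtain rfl : v1 = (1 + t) * x * v0 := by linear_combination e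
          have h7 : b < a := by omega
          simp [cornerWt, h7]
          ring
        · obtain ⟨rfl, rfl⟩ := i3 ha
          have h7 : ¬ b < a := by omega
          simp [cornerWt, h7]
      · have h4 : b < c - 1 := by omega
        rcases hl.eq_or_lt with rfl | h7
        · obtain ⟨rfl, rfl⟩ := i3 h3
          obtain rfl := i4 hc
          simp
        · simp [cornerWt, h1, h2, h3, h4, h7, hk, hc]
          ring
    · have r2 : rowWt x b (d - 1) = 0 := by rw [rowWt, if_neg (by omega)]
      have r3 : rowWt x (b + 1) d = 0 := by rw [rowWt, if_neg (by omega)]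
      simp [r2, r3]

/-- The invariant relating the two transfer vectors after each row. -/
lemma transferVec_invariant (t x : R) (lam kap : ℕ → ℤ) (hlam : Antitone lam)
    (hkap : Antitone kap) (n : ℕ) :
    let v := transferVec
      (fun b => rowWt x (lam 0) (kap 0 - bit b) *
        boxWt t (kap 0 - bit b + 1) (kap 0 - bit b) (kap 0))
      (fun i b c => cornerWt x (lam (i + 1)) (kap i - bit b) *
        (rowWt x (lam (i + 1)) (kap (i + 1) - bit c) *
          boxWt t (kap i - bit b) (kap (i + 1) - bit c) (kap (i + 1)))) n
    let w := transferVec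
      (fun b => rowWt x (lam 0 + bit b) (kap 0) * boxWt t (lam 0 + 1) (lam 0) (lam 0 + bit b))
      (fun i _ c => cornerWt x (lam (i + 1) + bit c) (kap i) *
        (rowWt x (lam (i + 1) + bit c) (kap (i + 1)) *
          boxWt t (lam i) (lam (i + 1)) (lam (i + 1) + bit c))) n
    v false + v true = w false + w true ∧
      (kap n ≤ lam n → v false + v true = (1 + (1 + t) * x) * v false) ∧
      (lam n < kap n → v false = 0 ∧ w false = 0) ∧
      (lam n + 1 < kap n → v true = 0) := by
  have pow_aux (e : ℤ) (he : 0 ≤ e) : x ^ (e + 1).toNat = x * x ^ e.toNat := by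
    rw [show (e + 1).toNat = e.toNat + 1 by omega, pow_succ']
  induction n with
  | zero =>
    simp only [transferVec, bit]
    rcases lt_trichotomy (kap 0) (lam 0 + 1) with h | h | h
    · have h1 : kap 0 ≤ lam 0 := by omega
      have h2 : x ^ (lam 0 - (kap 0 - 1)).toNat = x * x ^ (lam 0 - kap 0).toNat := by
        rw [← pow_aux _ (by omega)]; congr 2; ring
      have h3 : x ^ (lam 0 + 1 - kap 0).toNat = x * x ^ (lam 0 - kap 0).toNat := by
        rw [← pow_aux _ (by omega)]; congr 2; ring
      have h4 : kap 0 ≤ lam 0 + 1 := by omega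
      have h5 : kap 0 ≠ kap 0 - 1 := by omega
      simp [rowWt, boxWt, h1, h2, h3, h4, h5, not_lt.2 h1]
      ring
    · simp [rowWt, boxWt, h]
    · have h1 : ¬ kap 0 ≤ lam 0 := by omega
      have h2 : ¬ kap 0 - 1 ≤ lam 0 := by omega
      have h3 : ¬ kap 0 ≤ lam 0 + 1 := by omega
      simp [rowWt, boxWt, h1, h2, h3]
  | succ n ih =>
    simp only [transferVec]
    set v := transferVec
      (fun b => rowWt x (lam 0) (kap 0 - bit b) *
        boxWt t (kap 0 - bit b + 1) (kap 0 - bit b) (kap 0))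
      (fun i b c => cornerWt x (lam (i + 1)) (kap i - bit b) *
        (rowWt x (lam (i + 1)) (kap (i + 1) - bit c) *
          boxWt t (kap i - bit b) (kap (i + 1) - bit c) (kap (i + 1)))) n
    set w := transferVec
      (fun b => rowWt x (lam 0 + bit b) (kap 0) * boxWt t (lam 0 + 1) (lam 0) (lam 0 + bit b))
      (fun i _ c => cornerWt x (lam (i + 1) + bit c) (kap i) *
        (rowWt x (lam (i + 1) + bit c) (kap (i + 1)) *
          boxWt t (lam i) (lam (i + 1)) (lam (i + 1) + bit c))) n
    obtain ⟨i1, i2, i3, i4⟩ := ih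
    have hl : lam (n + 1) ≤ lam n := hlam (Nat.le_succ n)
    have hk : kap (n + 1) ≤ kap n := hkap (Nat.le_succ n)
    generalize hv0 : v false = v0 at *
    generalize hv1 : v true = v1 at *
    generalize hw0 : w false = w0 at *
    generalize hw1 : w true = w1 at *
    generalize lam n = a at *
    generalize lam (n + 1) = b at *
    generalize kap n = c at *
    generalize kap (n + 1) = d at *
    simp only [bit, if_true, Bool.false_eq_true, if_false, sub_zero, add_zero]
    exact transferStep_invariant t x i1 i2 i3 i4 hl hk

/-- **One-variable Pieri identity.** -/
theorem sum_branch_strip_eq_sum_strip_branch (n : ℕ) (t x : R) {lam kap : ℕ → ℤ}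
    (hlam : Antitone lam) (hkap : Antitone kap) (hlam' : lam (n + 1) = 0) (hkap' : kap n = 0) :
    (1 + (1 + t) * x) * ∑ A ∈ (Finset.range (n + 1)).powerset,
      branchWt (n + 1) x lam (fun i => kap i - bit (decide (i ∈ A))) *
        stripWt (n + 1) t kap (fun i => kap i - bit (decide (i ∈ A))) =
    ∑ A ∈ (Finset.range (n + 1)).powerset,
      stripWt (n + 1) t (fun i => lam i + bit (decide (i ∈ A))) lam *
        branchWt (n + 1) x (fun i => lam i + bit (decide (i ∈ A))) kap := by
  rw [sum_branchWt_mul_stripWt, sum_stripWt_mul_branchWt]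
  obtain ⟨i1, i2, -, -⟩ := transferVec_invariant t x lam kap hlam hkap n
  have h0 : kap n ≤ lam n := by
    have := hlam (Nat.le_add_right n 1)
    omega
  have e := i2 h0
  rw [i1] at e
  rw [Fintype.sum_bool, Fintype.sum_bool, hlam', hkap']
  have c1 : cornerWt x 0 (0 - bit true) = 0 := by simp [cornerWt, bit]
  have c2 : cornerWt x 0 (0 - bit false) = 1 := by simp [cornerWt, bit]
  have c3 : cornerWt x 0 0 = 1 := by simp [cornerWt]
  rw [c1, c2, c3]
  linear_combination -e

end Transfer
/-! ### Set-valued tableaux with bounded entries -/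

namespace SVT

lemma ext_entry {cells : Finset (ℕ × ℕ)} {T U : SVT cells} (h : T.entry = U.entry) : T = U := by
  cases T; cases U; congr

instance finite_bounded (cells : Finset (ℕ × ℕ)) (m : ℕ) :
    Finite {T : SVT cells // T.Bounded m} := by
  refine Finite.of_injective (β := cells → (Finset.range m).powerset)
    (fun T c => ⟨T.1.entry c, Finset.mem_powerset.2 fun x hx => Finset.mem_range.2 (T.2 c x hx)⟩) ?_
  intro T U h
  refine Subtype.ext (ext_entry (funext fun c => ?_))
  by_cases hc : c ∈ cells
  · exact congrArg Subtype.val (congrFun h ⟨c, hc⟩)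
  · rw [T.1.eq_empty_of_not_mem c hc, U.1.eq_empty_of_not_mem c hc]

noncomputable instance (cells : Finset (ℕ × ℕ)) (m : ℕ) :
    Fintype {T : SVT cells // T.Bounded m} := Fintype.ofFinite _

lemma mem_cells_of_mem_entry {cells : Finset (ℕ × ℕ)} (T : SVT cells) {c : ℕ × ℕ} {x : ℕ}
    (h : x ∈ T.entry c) : c ∈ cells := by
  by_contra hc
  simp [T.eq_empty_of_not_mem c hc] at h

lemma le_of_mem_entry_zero {mu : YoungDiagram} (T : SVT mu.cells) {i x : ℕ}
    (h : x ∈ T.entry (i, 0)) : i ≤ x := by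
  induction i generalizing x with
  | zero => exact Nat.zero_le x
  | succ i ih =>
    have hc := T.mem_cells_of_mem_entry h
    have hc' : (i, 0) ∈ mu.cells := mu.isLowerSet (a := (i + 1, 0)) ⟨by simp, le_rfl⟩ hc
    obtain ⟨y, hy⟩ := T.nonempty_of_mem _ hc'
    exact lt_of_le_of_lt (ih hy) (T.col_strict i 0 hc' hc y hy x h)

lemma Bounded.rowLen_eq_zero {mu : YoungDiagram} {T : SVT mu.cells} {m i : ℕ} (hT : T.Bounded m)
    (hi : m ≤ i) : mu.rowLen i = 0 := by
  by_contra h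
  have hc : (i, 0) ∈ mu.cells :=
    (YoungDiagram.mem_cells _).2 (YoungDiagram.mem_iff_lt_rowLen.2 (Nat.pos_of_ne_zero h))
  obtain ⟨x, hx⟩ := T.nonempty_of_mem _ hc
  exact absurd (T.le_of_mem_entry_zero hx) (by have := hT _ x hx; omega)

end SVT

/-- The weight generating function of set-valued tableaux with entries `< m`. -/
noncomputable def svtSum (m : ℕ) (mu : YoungDiagram) : MvPolynomial ℕ ℤ :=
  ∑ T : {T : SVT mu.cells // T.Bounded m}, T.1.monomial

lemma svtSum_eq_zero {m i : ℕ} {mu : YoungDiagram} (hi : m ≤ i) (h : mu.rowLen i ≠ 0) :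
    svtSum m mu = 0 :=
  Finset.sum_eq_zero fun T _ => absurd (T.2.rowLen_eq_zero hi) h

namespace YoungDiagram

lemma ext_rowLen {mu nu : YoungDiagram} (h : ∀ i, mu.rowLen i = nu.rowLen i) : mu = nu := by
  refine YoungDiagram.ext (Finset.ext fun c => ?_)
  rw [YoungDiagram.mem_cells, YoungDiagram.mem_cells, ← Prod.mk.eta (p := c),
    YoungDiagram.mem_iff_lt_rowLen, YoungDiagram.mem_iff_lt_rowLen, h]

lemma rowLen_bot (i : ℕ) : (⊥ : YoungDiagram).rowLen i = 0 := by
  by_contra h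
  have : (i, 0) ∈ (⊥ : YoungDiagram) :=
    YoungDiagram.mem_iff_lt_rowLen.2 (Nat.pos_of_ne_zero h)
  simp at this

lemma le_iff_rowLen_le {mu nu : YoungDiagram} : mu ≤ nu ↔ ∀ i, mu.rowLen i ≤ nu.rowLen i := by
  constructor
  · intro h i
    by_contra! hlt
    have h1 : (i, nu.rowLen i) ∈ mu := YoungDiagram.mem_iff_lt_rowLen.2 hlt
    exact lt_irrefl _ (YoungDiagram.mem_iff_lt_rowLen.1 (h h1))
  · rintro h ⟨i, j⟩ hc
    exact YoungDiagram.mem_iff_lt_rowLen.2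
      ((YoungDiagram.mem_iff_lt_rowLen.1 hc).trans_le (h i))

/-- The Young diagram with prescribed row lengths. -/
lemma exists_rowLen_eq {N : ℕ} {f : ℕ → ℕ} (hf : Antitone f) (hN : f N = 0) :
    ∃ mu : YoungDiagram, ∀ i, mu.rowLen i = f i := by
  refine ⟨⟨(Finset.range N ×ˢ Finset.range (f 0)).filter fun c => c.2 < f c.1, ?_⟩, fun i => ?_⟩
  · rintro ⟨a, b⟩ ⟨a', b'⟩ ⟨h1, h2⟩ h
    simp only [Finset.coe_filter, Finset.mem_product, Finset.mem_range, Set.mem_ofPred_eq] at h ⊢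
    simp only at h1 h2
    have := hf h1
    omega
  · refine eq_of_forall_lt_iff fun j => ?_
    rw [← YoungDiagram.mem_iff_lt_rowLen, ← YoungDiagram.mem_cells]
    simp only [Finset.mem_filter, Finset.mem_product, Finset.mem_range, and_iff_right_iff_imp]
    intro h
    have h0 := hf (Nat.zero_le i)
    refine ⟨?_, by omega⟩
    by_contra! hi
    have := hf hi
    omega

/-- The Young diagrams with at most `N` rows, of length at most `M`. -/
noncomputable def inBox (N M : ℕ) : Finset YoungDiagram :=
  Set.Finite.toFinset (s := {mu : YoungDiagram | mu.rowLen N = 0 ∧ mu.rowLen 0 ≤ M}) <| by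
    refine Set.Finite.of_injOn (f := YoungDiagram.cells)
      (t := ((Finset.range N ×ˢ Finset.range M).powerset : Finset (Finset (ℕ × ℕ))))
      ?_ (fun mu _ nu _ h => YoungDiagram.ext h) (Finset.finite_toSet _)
    rintro mu ⟨h1, h2⟩
    refine Finset.mem_coe.2 (Finset.mem_powerset.2 ?_)
    rintro ⟨i, j⟩ hc
    have hj := YoungDiagram.mem_iff_lt_rowLen.1 ((YoungDiagram.mem_cells _).1 hc)
    have h0 := mu.rowLen_anti 0 i (Nat.zero_le i)
    refine Finset.mem_product.2 ⟨Finset.mem_range.2 ?_, Finset.mem_range.2 (by omega)⟩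
    by_contra! hi
    have := mu.rowLen_anti N i hi
    omega

lemma mem_inBox {N M : ℕ} {mu : YoungDiagram} :
    mu ∈ inBox N M ↔ mu.rowLen N = 0 ∧ mu.rowLen 0 ≤ M := by
  simp [inBox]

lemma prod_cells {R : Type*} [CommMonoid R] {N : ℕ} {mu : YoungDiagram} (hN : mu.rowLen N = 0)
    (f : ℕ × ℕ → R) :
    ∏ c ∈ mu.cells, f c = ∏ i ∈ Finset.range N, ∏ j ∈ Finset.range (mu.rowLen i), f (i, j) := by
  refine Finset.prod_finset_product _ _ _ ?_
  rintro ⟨i, j⟩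
  rw [YoungDiagram.mem_cells, YoungDiagram.mem_iff_lt_rowLen, Finset.mem_range, Finset.mem_range]
  refine ⟨fun h => ⟨?_, h⟩, And.right⟩
  by_contra! hi
  have := mu.rowLen_anti N i hi
  omega

/-- The row lengths, as integers. -/
def rows (mu : YoungDiagram) (i : ℕ) : ℤ := mu.rowLen i

lemma rows_antitone (mu : YoungDiagram) : Antitone mu.rows :=
  fun i j h => by simpa [rows] using mu.rowLen_anti i j h

end YoungDiagram

open YoungDiagram

/-! ### The branching rule -/

section Branching

variable {m : ℕ} {lam mu : YoungDiagram}

/-- The skew diagram `lam / mu` is a horizontal strip. -/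
def Interlaces (lam mu : YoungDiagram) : Prop :=
  ∀ i, lam.rowLen (i + 1) ≤ mu.rowLen i ∧ mu.rowLen i ≤ lam.rowLen i

/-- The boxes filled with the largest entry: those of `lam / mu` and the last boxes of the rows
of `mu` in `K`. -/
def LargestBox (lam mu : YoungDiagram) (K : Finset ℕ) (c : ℕ × ℕ) : Prop :=
  c.2 < lam.rowLen c.1 ∧ (mu.rowLen c.1 ≤ c.2 ∨ c.1 ∈ K ∧ c.2 + 1 = mu.rowLen c.1)

instance (lam mu : YoungDiagram) (K : Finset ℕ) : DecidablePred (LargestBox lam mu K) :=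
  fun _ => inferInstanceAs (Decidable (_ ∧ _))

lemma mem_union_ite_singleton {s : Finset ℕ} {p : Prop} [Decidable p] {x m : ℕ} :
    x ∈ s ∪ (if p then {m} else ∅) ↔ x ∈ s ∨ p ∧ x = m := by
  split_ifs with h <;> simp [h, or_comm]

/-- Add the entry `m` to a tableau with smaller entries. -/
def SVT.addLargest (h : Interlaces lam mu) (T : SVT mu.cells) (hT : T.Bounded m) (K : Finset ℕ)
    (hK : ∀ i ∈ K, lam.rowLen (i + 1) < mu.rowLen i) : SVT lam.cells where
  entry c := T.entry c ∪ if LargestBox lam mu K c then {m} else ∅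
  nonempty_of_mem := by
    rintro ⟨i, j⟩ hc
    by_cases hc' : (i, j) ∈ mu.cells
    · exact (T.nonempty_of_mem _ hc').mono Finset.subset_union_left
    · rw [mem_cells, mem_iff_lt_rowLen] at hc hc'
      exact ⟨m, mem_union_ite_singleton.2 (Or.inr ⟨⟨hc, Or.inl (not_lt.1 hc')⟩, rfl⟩)⟩
  eq_empty_of_not_mem := by
    rintro ⟨i, j⟩ hc
    have h1 : ¬ LargestBox lam mu K (i, j) := fun h =>
      hc ((mem_cells _).2 (mem_iff_lt_rowLen.2 h.1))
    have h2 : (i, j) ∉ mu.cells := fun h2 => hc (by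
      rw [mem_cells, mem_iff_lt_rowLen] at h2 ⊢
      exact h2.trans_le (h i).2)
    simp [h1, T.eq_empty_of_not_mem _ h2]
  row_weak := by
    intro i j hc hc' a ha b hb
    rw [mem_union_ite_singleton] at ha hb
    rcases hb with hb | ⟨-, rfl⟩
    · have hb' := T.mem_cells_of_mem_entry hb
      rcases ha with ha | ⟨ha, -⟩
      · exact T.row_weak i j (T.mem_cells_of_mem_entry ha) hb' a ha b hb
      · rw [mem_cells, mem_iff_lt_rowLen] at hb'
        obtain ⟨-, ha | ⟨-, ha⟩⟩ := ha <;> simp only at ha <;> omega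
    · rcases ha with ha | ⟨-, rfl⟩
      · exact (hT _ a ha).le
      · exact le_rfl
  col_strict := by
    intro i j hc hc' a ha b hb
    rw [mem_union_ite_singleton] at ha hb
    rcases ha with ha | ⟨⟨-, ha⟩, rfl⟩
    · rcases hb with hb | ⟨-, rfl⟩
      · exact T.col_strict i j (T.mem_cells_of_mem_entry ha) (T.mem_cells_of_mem_entry hb) a ha b hb
      · exact hT _ a ha
    · rw [mem_cells, mem_iff_lt_rowLen] at hc'
      have := (h i).1
      rcases ha with ha | ⟨hi, ha⟩
      · simp only at ha
        omega
      · have := hK i hi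
        simp only at ha
        omega

lemma SVT.mem_addLargest_entry (h : Interlaces lam mu) (T : SVT mu.cells) (hT : T.Bounded m)
    (K : Finset ℕ) (hK : ∀ i ∈ K, lam.rowLen (i + 1) < mu.rowLen i) {c : ℕ × ℕ} {x : ℕ} :
    x ∈ (T.addLargest h hT K hK).entry c ↔ x ∈ T.entry c ∨ LargestBox lam mu K c ∧ x = m :=
  mem_union_ite_singleton

lemma SVT.addLargest_bounded (h : Interlaces lam mu) (T : SVT mu.cells) (hT : T.Bounded m)
    (K : Finset ℕ) (hK : ∀ i ∈ K, lam.rowLen (i + 1) < mu.rowLen i) :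
    (T.addLargest h hT K hK).Bounded (m + 1) := by
  intro c x hx
  rcases (T.mem_addLargest_entry h hT K hK).1 hx with hx | ⟨-, rfl⟩
  · exact (hT c x hx).trans (Nat.lt_succ_self m)
  · exact Nat.lt_succ_self x

lemma prod_range_largestBox {R : Type*} [CommMonoid R] (h : Interlaces lam mu) {K : Finset ℕ}
    (hK : ∀ i ∈ K, lam.rowLen (i + 1) < mu.rowLen i) (x : R) (i : ℕ) :
    ∏ j ∈ Finset.range (lam.rowLen i), (if LargestBox lam mu K (i, j) then x else 1) =
      x ^ (lam.rowLen i - mu.rowLen i) * if i ∈ K then x else 1 := by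
  rw [← Finset.prod_filter, Finset.prod_const]
  have hi := (h i).2
  split_ifs with hiK
  · have := hK i hiK
    have : (Finset.range (lam.rowLen i)).filter (fun j => LargestBox lam mu K (i, j)) =
        Finset.Ico (mu.rowLen i - 1) (lam.rowLen i) := by
      ext j
      simp only [Finset.mem_filter, Finset.mem_range, LargestBox, hiK, Finset.mem_Ico,
        true_and]
      omega
    rw [this, Nat.card_Ico, ← pow_succ]
    congr 1
    omega
  · have : (Finset.range (lam.rowLen i)).filter (fun j => LargestBox lam mu K (i, j)) =
        Finset.Ico (mu.rowLen i) (lam.rowLen i) := by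
      ext j
      simp only [Finset.mem_filter, Finset.mem_range, LargestBox, hiK, Finset.mem_Ico,
        false_and, or_false]
      omega
    rw [this, Nat.card_Ico, mul_one]

lemma SVT.addLargest_monomial {N : ℕ} (hN : lam.rowLen N = 0) (h : Interlaces lam mu)
    (T : SVT mu.cells) (hT : T.Bounded m) {K : Finset ℕ} (hKN : K ⊆ Finset.range N)
    (hK : ∀ i ∈ K, lam.rowLen (i + 1) < mu.rowLen i) :
    (T.addLargest h hT K hK).monomial =
      (∏ i ∈ Finset.range N, X m ^ (lam.rowLen i - mu.rowLen i)) * (∏ _i ∈ K, X m) *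
        T.monomial := by
  have hsub : mu.cells ⊆ lam.cells := by
    rintro ⟨i, j⟩ hc
    rw [mem_cells, mem_iff_lt_rowLen] at hc ⊢
    exact hc.trans_le (h i).2
  have h1 : (T.addLargest h hT K hK).monomial = ∏ c ∈ lam.cells,
      ((∏ x ∈ T.entry c, (X x : MvPolynomial ℕ ℤ)) *
        if LargestBox lam mu K c then X m else 1) := by
    refine Finset.prod_congr rfl fun c _ => ?_
    have hdis : Disjoint (T.entry c) (if LargestBox lam mu K c then {m} else ∅) := by
      rw [Finset.disjoint_left]
      intro x hx hx'
      split_ifs at hx'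
      · exact absurd (hT c x hx) (by rw [Finset.mem_singleton.1 hx']; exact lt_irrefl _)
      · simp at hx'
    change ∏ x ∈ T.entry c ∪ _, _ = _
    rw [Finset.prod_union hdis]
    split_ifs <;> simp
  rw [h1, Finset.prod_mul_distrib, ← Finset.prod_subset hsub, prod_cells hN,
    Finset.prod_congr rfl fun i _ => prod_range_largestBox h hK (X m : MvPolynomial ℕ ℤ) i,
    Finset.prod_mul_distrib, ← Finset.prod_filter]
  · have : (Finset.range N).filter (· ∈ K) = K := by
      rw [Finset.filter_mem_eq_inter, Finset.inter_eq_right.2 hKN]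
    rw [this, SVT.monomial, mul_comm]
  · intro c _ hc
    simp [T.eq_empty_of_not_mem c hc]

lemma SVT.addLargest_injective {mu' : YoungDiagram} {h : Interlaces lam mu}
    {h' : Interlaces lam mu'} {T : SVT mu.cells} {T' : SVT mu'.cells} {hT : T.Bounded m}
    {hT' : T'.Bounded m} {K K' : Finset ℕ} {hK : ∀ i ∈ K, lam.rowLen (i + 1) < mu.rowLen i}
    {hK' : ∀ i ∈ K', lam.rowLen (i + 1) < mu'.rowLen i}
    (e : T.addLargest h hT K hK = T'.addLargest h' hT' K' hK') :
    (⟨mu, T, K⟩ : Σ nu : YoungDiagram, SVT nu.cells × Finset ℕ) = ⟨mu', T', K'⟩ := by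
  have key (c : ℕ × ℕ) (x : ℕ) : (x ∈ T.entry c ∨ LargestBox lam mu K c ∧ x = m) ↔
      (x ∈ T'.entry c ∨ LargestBox lam mu' K' c ∧ x = m) := by
    rw [← T.mem_addLargest_entry h hT K hK, e, T'.mem_addLargest_entry h' hT' K' hK']
  have hent : T.entry = T'.entry := by
    funext c
    ext x
    constructor
    · intro hx
      exact ((key c x).1 (Or.inl hx)).resolve_right fun hh => absurd (hT c x hx) (by omega)
    · intro hx
      exact ((key c x).2 (Or.inl hx)).resolve_right fun hh => absurd (hT' c x hx) (by omega)
  obtain rfl : mu = mu' := by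
    refine YoungDiagram.ext (Finset.ext fun c => ⟨fun hc => ?_, fun hc => ?_⟩)
    · obtain ⟨x, hx⟩ := T.nonempty_of_mem c hc
      exact T'.mem_cells_of_mem_entry (hent ▸ hx)
    · obtain ⟨x, hx⟩ := T'.nonempty_of_mem c hc
      exact T.mem_cells_of_mem_entry (hent ▸ hx)
  obtain rfl := SVT.ext_entry hent
  have hlarge (c : ℕ × ℕ) : LargestBox lam mu K c ↔ LargestBox lam mu K' c := by
    have hm : m ∉ T.entry c := fun hx => lt_irrefl m (hT c m hx)
    simpa [hm] using key c m
  have hKK : K = K' := by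
    have aux {K : Finset ℕ} (hK : ∀ i ∈ K, lam.rowLen (i + 1) < mu.rowLen i) (i : ℕ) :
        i ∈ K ↔ 0 < mu.rowLen i ∧ LargestBox lam mu K (i, mu.rowLen i - 1) := by
      have := h i
      have := hK i
      simp only [LargestBox]
      constructor
      · intro hi
        have := hK i hi
        exact ⟨by omega, by omega, Or.inr ⟨hi, by omega⟩⟩
      · rintro ⟨h0, -, hi | hi⟩
        · omega
        · exact hi.1
    ext i
    rw [aux hK, aux hK', hlarge]
  rw [hKK]

lemma SVT.exists_addLargest {N : ℕ} (hN : lam.rowLen N = 0) (T : SVT lam.cells)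
    (hT : T.Bounded (m + 1)) :
    ∃ (mu : YoungDiagram) (h : Interlaces lam mu) (U : SVT mu.cells) (hU : U.Bounded m)
      (K : Finset ℕ) (hK : ∀ i ∈ K, lam.rowLen (i + 1) < mu.rowLen i), K ⊆ Finset.range N ∧
      U.addLargest h hU K hK = T := by
  have hmem {c : ℕ × ℕ} (hc : c ∈ lam.cells) {i j : ℕ} (h1 : i ≤ c.1) (h2 : j ≤ c.2) :
      (i, j) ∈ lam.cells := lam.isLowerSet (a := c) ⟨h1, h2⟩ hc
  have hstep_row (i j : ℕ) (h : ∃ x ∈ T.entry (i, j + 1), x < m) :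
      ∃ x ∈ T.entry (i, j), x < m := by
    obtain ⟨x, hx, hxm⟩ := h
    have hc := T.mem_cells_of_mem_entry hx
    have hc' := hmem hc (le_refl i) (Nat.le_succ j)
    obtain ⟨y, hy⟩ := T.nonempty_of_mem _ hc'
    exact ⟨y, hy, (T.row_weak i j hc' hc y hy x hx).trans_lt hxm⟩
  have hstep_col (i j : ℕ) (hc : (i + 1, j) ∈ lam.cells) :
      ∀ x ∈ T.entry (i, j), x < m := by
    intro x hx
    obtain ⟨y, hy⟩ := T.nonempty_of_mem _ hc
    have := T.col_strict i j (hmem hc (Nat.le_succ i) le_rfl) hc x hx y hy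
    have := hT _ y hy
    omega
  let mu : YoungDiagram := ⟨lam.cells.filter fun c => ∃ x ∈ T.entry c, x < m, by
    rintro ⟨i, j⟩ ⟨i', j'⟩ ⟨h1, h2⟩ h
    simp only [Finset.coe_filter, Set.mem_ofPred_eq] at h ⊢ h1 h2
    refine ⟨hmem h.1 h1 h2, ?_⟩
    obtain ⟨hc, h⟩ := h
    have hrow : ∃ x ∈ T.entry (i, j'), x < m := by
      clear hc
      induction h2 with
      | refl => exact h
      | step _ ih => exact ih (hstep_row _ _ h)
    rcases h1.eq_or_lt with rfl | h1
    · exact hrow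
    · have hc' : (i' + 1, j') ∈ lam.cells := hmem hc h1 h2
      obtain ⟨x, hx⟩ := T.nonempty_of_mem _ (hmem hc' (Nat.le_succ i') le_rfl)
      exact ⟨x, hx, hstep_col _ _ hc' x hx⟩⟩
  have hmu (i j : ℕ) : j < mu.rowLen i ↔ ∃ x ∈ T.entry (i, j), x < m := by
    rw [← mem_iff_lt_rowLen, ← mem_cells]
    simp only [mu, Finset.mem_filter, and_iff_right_iff_imp]
    rintro ⟨x, hx, -⟩
    exact T.mem_cells_of_mem_entry hx
  have hlam (i j : ℕ) : j < lam.rowLen i ↔ (i, j) ∈ lam.cells := by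
    rw [← mem_iff_lt_rowLen, ← mem_cells]
  have h : Interlaces lam mu := by
    refine fun i => ⟨?_, ?_⟩
    · refine le_of_forall_lt fun j hj => ?_
      rw [hlam] at hj
      obtain ⟨x, hx⟩ := T.nonempty_of_mem _ (hmem hj (Nat.le_succ i) le_rfl)
      exact (hmu i j).2 ⟨x, hx, hstep_col _ _ hj x hx⟩
    · refine le_of_forall_lt fun j hj => ?_
      obtain ⟨x, hx, -⟩ := (hmu i j).1 hj
      exact (hlam i j).2 (T.mem_cells_of_mem_entry hx)
  let U : SVT mu.cells :=
    { entry := fun c => (T.entry c).filter (· < m)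
      nonempty_of_mem := fun c hc => by
        obtain ⟨x, hx, hxm⟩ := (Finset.mem_filter.1 hc).2
        exact ⟨x, Finset.mem_filter.2 ⟨hx, hxm⟩⟩
      eq_empty_of_not_mem := fun c hc => by
        refine Finset.filter_eq_empty_iff.2 fun x hx hxm => hc ?_
        exact Finset.mem_filter.2 ⟨T.mem_cells_of_mem_entry hx, x, hx, hxm⟩
      row_weak := fun i j hc hc' a ha b hb =>
        T.row_weak i j (Finset.mem_filter.1 hc).1 (Finset.mem_filter.1 hc').1 a
          (Finset.mem_filter.1 ha).1 b (Finset.mem_filter.1 hb).1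
      col_strict := fun i j hc hc' a ha b hb =>
        T.col_strict i j (Finset.mem_filter.1 hc).1 (Finset.mem_filter.1 hc').1 a
          (Finset.mem_filter.1 ha).1 b (Finset.mem_filter.1 hb).1 }
  let K := (Finset.range N).filter fun i => 0 < mu.rowLen i ∧ m ∈ T.entry (i, mu.rowLen i - 1)
  have hK : ∀ i ∈ K, lam.rowLen (i + 1) < mu.rowLen i := by
    intro i hi
    obtain ⟨-, h0, hi⟩ := Finset.mem_filter.1 hi
    by_contra! hlt
    exact lt_irrefl m (hstep_col i (mu.rowLen i - 1) ((hlam _ _).1 (by omega)) m hi)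
  have hU : U.Bounded m := fun c x hx => (Finset.mem_filter.1 hx).2
  refine ⟨mu, h, U, hU, K, hK, Finset.filter_subset _ _,
    SVT.ext_entry (funext fun c => Finset.ext fun x => ?_)⟩
  obtain ⟨i, j⟩ := c
  refine (SVT.mem_addLargest_entry h U hU K hK).trans ?_
  have hlarge : LargestBox lam mu K (i, j) ↔ m ∈ T.entry (i, j) := by
    simp only [LargestBox]
    constructor
    · rintro ⟨h1, h2 | ⟨h2, h3⟩⟩
      · obtain ⟨x, hx⟩ := T.nonempty_of_mem _ ((hlam i j).1 h1)
        have hxm : ¬ x < m := fun hxm => absurd ((hmu i j).2 ⟨x, hx, hxm⟩) (not_lt.2 h2)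
        have := hT _ x hx
        rwa [show m = x by omega]
      · have := (Finset.mem_filter.1 h2).2.2
        rwa [← h3] at this
    · intro hm
      have hc := T.mem_cells_of_mem_entry hm
      refine ⟨(hlam i j).2 hc, ?_⟩
      by_contra! hcon
      obtain ⟨h1, h2⟩ := hcon
      have h3 : ¬ j + 1 < mu.rowLen i := fun h3 => by
        obtain ⟨x, hx, hxm⟩ := (hmu _ _).1 h3
        have := T.row_weak i j hc (T.mem_cells_of_mem_entry hx) m hm x hx
        omega
      have h4 : mu.rowLen i = j + 1 := by omega
      refine h2 (Finset.mem_filter.2 ⟨Finset.mem_range.2 ?_, by omega, ?_⟩) h4.symm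
      · by_contra! hi
        have := lam.rowLen_anti N i hi
        have := (hlam i j).2 hc
        omega
      · rwa [h4, Nat.add_sub_cancel]
  rw [hlarge]
  simp only [U, Finset.mem_filter]
  constructor
  · rintro (hx | ⟨hx, rfl⟩)
    · exact hx.1
    · exact hx
  · intro hx
    have := hT _ x hx
    rcases lt_or_eq_of_le (Nat.lt_succ_iff.1 this) with h1 | rfl
    · exact Or.inl ⟨hx, h1⟩
    · exact Or.inr ⟨hx, rfl⟩

lemma branchWt_eq {R : Type*} [CommRing R] {N : ℕ} (h : Interlaces lam mu) (x : R) :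
    branchWt N x lam.rows mu.rows = ∑ K ∈
      ((Finset.range N).filter fun i => lam.rowLen (i + 1) < mu.rowLen i).powerset,
        (∏ i ∈ Finset.range N, x ^ (lam.rowLen i - mu.rowLen i)) * ∏ _i ∈ K, x := by
  rw [← Finset.mul_sum, ← Finset.prod_one_add, branchWt, Finset.prod_mul_distrib,
    Finset.prod_filter]
  congr 1
  · refine Finset.prod_congr rfl fun i _ => ?_
    have := (h i).2
    rw [rowWt, if_pos (by simpa [rows] using this)]
    congr 1
    simp only [rows]
    omega
  · refine Finset.prod_congr rfl fun i _ => ?_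
    have := (h i).1
    rw [cornerWt, if_pos (by simpa [rows] using this)]
    simp [rows]

lemma interlaces_of_branchWt_ne_zero {R : Type*} [CommRing R] {N : ℕ} {x : R} {a b : ℕ → ℤ}
    (h : branchWt N x a b ≠ 0) {i : ℕ} (hi : i < N) : a (i + 1) ≤ b i ∧ b i ≤ a i := by
  by_contra hcon
  refine h (Finset.prod_eq_zero (Finset.mem_range.2 hi) ?_)
  rw [rowWt, cornerWt]
  split_ifs with h1 h2
  · exact absurd ⟨h2, h1⟩ hcon
  · exact absurd ⟨h2, h1⟩ hcon
  all_goals simp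

lemma rows_eq_zero {N i : ℕ} (hN : mu.rowLen N = 0) (hi : N ≤ i) : mu.rowLen i = 0 := by
  have := mu.rowLen_anti N i hi
  omega

/-- **Branching rule**: removing the largest entry from set-valued tableaux. -/
theorem svtSum_succ {N M : ℕ} (hlam : lam ∈ inBox N M) :
    svtSum (m + 1) lam =
      ∑ mu ∈ inBox N M, branchWt N (X m) lam.rows mu.rows * svtSum m mu := by
  classical
  obtain ⟨hN, hM⟩ := mem_inBox.1 hlam
  have h1 : ∑ mu ∈ inBox N M, branchWt N (X m) lam.rows mu.rows * svtSum m mu =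
      ∑ mu ∈ (inBox N M).filter (Interlaces lam),
        branchWt N (X m) lam.rows mu.rows * svtSum m mu := by
    refine (Finset.sum_filter_of_ne fun mu hmu hne i => ?_).symm
    rcases lt_or_ge i N with hi | hi
    · have := interlaces_of_branchWt_ne_zero (left_ne_zero_of_mul hne) hi
      simpa [rows] using this
    · have := rows_eq_zero (mem_inBox.1 hmu).1 hi
      have := rows_eq_zero hN hi
      have : lam.rowLen (i + 1) = 0 := rows_eq_zero hN (by omega)
      omega
  have h2 : ∑ mu ∈ (inBox N M).filter (Interlaces lam),
        branchWt N (X m) lam.rows mu.rows * svtSum m mu =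
      ∑ p ∈ ((inBox N M).filter (Interlaces lam)).sigma (fun mu =>
        ((Finset.range N).filter fun i => lam.rowLen (i + 1) < mu.rowLen i).powerset ×ˢ
          (Finset.univ : Finset {T : SVT mu.cells // T.Bounded m})),
        (∏ i ∈ Finset.range N, X m ^ (lam.rowLen i - p.1.rowLen i)) * (∏ _i ∈ p.2.1, X m) *
          p.2.2.1.monomial := by
    rw [Finset.sum_sigma]
    refine Finset.sum_congr rfl fun mu hmu => ?_
    rw [branchWt_eq (Finset.mem_filter.1 hmu).2, svtSum, Finset.sum_mul_sum,
      Finset.sum_product]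
  rw [h1, h2, svtSum]
  symm
  have hmem {p : Σ mu : YoungDiagram, Finset ℕ × {T : SVT mu.cells // T.Bounded m}}
      (hp : p ∈ ((inBox N M).filter (Interlaces lam)).sigma (fun mu =>
        ((Finset.range N).filter fun i => lam.rowLen (i + 1) < mu.rowLen i).powerset ×ˢ
          (Finset.univ : Finset {T : SVT mu.cells // T.Bounded m}))) :
      Interlaces lam p.1 ∧ p.2.1 ⊆ Finset.range N ∧
        ∀ i ∈ p.2.1, lam.rowLen (i + 1) < p.1.rowLen i := by
    obtain ⟨h1, h2⟩ := Finset.mem_sigma.1 hp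
    have h3 := Finset.mem_powerset.1 (Finset.mem_product.1 h2).1
    exact ⟨(Finset.mem_filter.1 h1).2, h3.trans (Finset.filter_subset _ _),
      fun i hi => (Finset.mem_filter.1 (h3 hi)).2⟩
  refine Finset.sum_bij
    (fun p hp => ⟨p.2.2.1.addLargest (hmem hp).1 p.2.2.2 p.2.1 (hmem hp).2.2,
      SVT.addLargest_bounded _ _ _ _ _⟩) (fun _ _ => Finset.mem_univ _) ?_ ?_ ?_
  · rintro ⟨mu, K, T, hT⟩ hp ⟨mu', K', T', hT'⟩ hp' e
    have := SVT.addLargest_injective (h := (hmem hp).1) (h' := (hmem hp').1) (hT := hT)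
      (hT' := hT') (hK := (hmem hp).2.2) (hK' := (hmem hp').2.2) (congrArg Subtype.val e)
    obtain ⟨rfl, h⟩ := Sigma.mk.inj_iff.1 this
    obtain ⟨rfl, rfl⟩ := Prod.mk.inj (eq_of_heq h)
    rfl
  · rintro ⟨T, hT⟩ -
    obtain ⟨mu, h, U, hU, K, hK, hKN, e⟩ := T.exists_addLargest hN hT
    refine ⟨⟨mu, K, U, hU⟩, ?_, Subtype.ext e⟩
    have hmuN : mu.rowLen N = 0 := by have := (h N).2; omega
    have hmuM : mu.rowLen 0 ≤ M := (h 0).2.trans hM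
    simp only [Finset.mem_sigma, Finset.mem_filter, Finset.mem_product, Finset.mem_powerset,
      Finset.mem_univ, and_true]
    exact ⟨⟨mem_inBox.2 ⟨hmuN, hmuM⟩, h⟩, fun i hi => Finset.mem_filter.2 ⟨hKN hi, hK i hi⟩⟩
  · intro p hp
    exact (SVT.addLargest_monomial hN (hmem hp).1 _ p.2.2.2 (hmem hp).2.1 (hmem hp).2.2).symm

end Branching

/-! ### The Pieri rule -/

lemma svtSum_bot (m : ℕ) : svtSum m ⊥ = 1 := by
  have h : ∀ T : {T : SVT (⊥ : YoungDiagram).cells // T.Bounded m}, T.1.monomial = 1 := by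
    intro T
    simp [SVT.monomial]
  have huniq : Nat.card {T : SVT (⊥ : YoungDiagram).cells // T.Bounded m} = 1 := by
    rw [Nat.card_eq_one_iff_unique]
    refine ⟨⟨fun T U => Subtype.ext (SVT.ext_entry (funext fun c => ?_))⟩, ⟨⟨⟨fun _ => ∅,
      by simp, by simp, by simp, by simp⟩, fun _ => by simp⟩⟩⟩
    rw [T.1.eq_empty_of_not_mem c (by simp), U.1.eq_empty_of_not_mem c (by simp)]
  rw [svtSum, Finset.sum_congr rfl fun T _ => h T, Finset.sum_const, Finset.card_univ,
    ← Nat.card_eq_fintype_card, huniq, one_smul]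

lemma svtSum_zero {mu : YoungDiagram} (h : mu ≠ ⊥) : svtSum 0 mu = 0 := by
  obtain ⟨i, hi⟩ : ∃ i, mu.rowLen i ≠ 0 := by
    by_contra! hcon
    exact h (ext_rowLen fun i => by rw [hcon, rowLen_bot])
  exact svtSum_eq_zero (Nat.zero_le i) hi

section Pieri

variable {R : Type*} [CommRing R]

lemma rows_injective : Function.Injective YoungDiagram.rows := fun mu nu h =>
  ext_rowLen fun i => by simpa [rows] using congrFun h i

lemma sum_inBox_eq_sum_powerset {N M : ℕ} {g : ℕ → ℤ} {d : Bool → ℤ} {F : (ℕ → ℤ) → R}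
    (hd0 : d false = 0) (hd1 : d true ≠ 0) (hg : ∀ i, N ≤ i → g i = 0)
    (h1 : ∀ mu : YoungDiagram, F mu.rows ≠ 0 →
      ∀ i < N, mu.rows i = g i ∨ mu.rows i = g i + d true)
    (h2 : ∀ A ⊆ Finset.range N, F (fun i => g i + d (decide (i ∈ A))) ≠ 0 →
      (∀ i < N, g (i + 1) + d (decide (i + 1 ∈ A)) ≤ g i + d (decide (i ∈ A))) ∧
        g 0 + d (decide (0 ∈ A)) ≤ M) :
    ∑ mu ∈ inBox N M, F mu.rows =
      ∑ A ∈ (Finset.range N).powerset, F (fun i => g i + d (decide (i ∈ A))) := by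
  have key (mu : YoungDiagram) (hmu : mu ∈ inBox N M) (hF : F mu.rows ≠ 0) :
      mu.rows = fun i => g i +
        d (decide (i ∈ (Finset.range N).filter fun i => mu.rows i ≠ g i)) := by
    funext i
    simp only [Finset.mem_filter, Finset.mem_range]
    by_cases hi : i < N
    · rcases h1 mu hF i hi with h | h
      · simp [h, hd0]
      · simp [h, hi, hd1]
    · simp [hi, hd0, hg i (not_lt.1 hi), rows, rows_eq_zero (mem_inBox.1 hmu).1 (not_lt.1 hi)]
  refine Finset.sum_bij_ne_zero (fun mu _ _ => (Finset.range N).filter fun i => mu.rows i ≠ g i)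
    (fun mu _ _ => Finset.mem_powerset.2 (Finset.filter_subset _ _)) ?_ ?_ ?_
  · intro mu hmu hF nu hnu hF' e
    exact rows_injective (by rw [key mu hmu hF, e, ← key nu hnu hF'])
  · intro A hA hF
    rw [Finset.mem_powerset] at hA
    obtain ⟨h3, h4⟩ := h2 A hA hF
    set f : ℕ → ℤ := fun i => g i + d (decide (i ∈ A)) with hf
    have hfN (i : ℕ) (hi : N ≤ i) : f i = 0 := by
      have : i ∉ A := fun h => absurd (Finset.mem_range.1 (hA h)) (not_lt.2 hi)
      simp [hf, this, hd0, hg i hi]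
    have hanti : Antitone f := by
      refine antitone_nat_of_succ_le fun i => ?_
      rcases lt_or_ge i N with hi | hi
      · exact h3 i hi
      · rw [hfN i hi, hfN (i + 1) (by omega)]
    have hnn (i : ℕ) : 0 ≤ f i := by
      rw [← hfN (max i N) (le_max_right i N)]
      exact hanti (le_max_left i N)
    obtain ⟨mu, hmu⟩ := exists_rowLen_eq (N := N) (f := fun i => (f i).toNat)
      (fun i j hij => Int.toNat_le_toNat (hanti hij)) (by simp [hfN])
    have hrows : mu.rows = f := funext fun i => by simp [rows, hmu, hnn]
    refine ⟨mu, mem_inBox.2 ⟨by simp [hmu, hfN], ?_⟩, by rwa [hrows], ?_⟩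
    · rw [hmu]
      simpa using h4
    · ext i
      rw [hrows]
      simp only [hf, Finset.mem_filter, Finset.mem_range]
      by_cases hi : i ∈ A
      · simp [hi, hd1, Finset.mem_range.1 (hA hi)]
      · simp [hi, hd0]
  · intro mu hmu hF
    exact congrArg F (key mu hmu hF)

lemma stripWt_ne_zero {N : ℕ} {t : R} {nu lam : ℕ → ℤ} (h : stripWt N t nu lam ≠ 0) {i : ℕ}
    (hi : i < N) : nu i = lam i ∨ nu i = lam i + 1 := by
  by_contra hcon
  refine h (Finset.prod_eq_zero (Finset.mem_range.2 hi) ?_)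
  rw [not_or] at hcon
  rw [boxWt, if_neg hcon.1, if_neg hcon.2]

lemma sum_inBox_branchWt_mul_stripWt {n M : ℕ} {lam kap : YoungDiagram} (t x : R)
    (hlam : lam ∈ inBox (n + 1) M) (hkap : kap ∈ inBox (n + 1) M) :
    ∑ mu ∈ inBox (n + 1) M, branchWt (n + 1) x lam.rows mu.rows *
        stripWt (n + 1) t kap.rows mu.rows =
      ∑ A ∈ (Finset.range (n + 1)).powerset,
        branchWt (n + 1) x lam.rows (fun i => kap.rows i - bit (decide (i ∈ A))) *
          stripWt (n + 1) t kap.rows (fun i => kap.rows i - bit (decide (i ∈ A))) := by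
  obtain ⟨hl, hM⟩ := mem_inBox.1 hlam
  have hk := (mem_inBox.1 hkap).1
  simp only [sub_eq_add_neg]
  refine sum_inBox_eq_sum_powerset (d := fun b => - bit b)
    (F := fun f => branchWt (n + 1) x lam.rows f * stripWt (n + 1) t kap.rows f)
    (by simp [bit]) (by simp [bit]) (fun i hi => by simp [rows, rows_eq_zero hk hi]) ?_ ?_
  · intro mu hF i hi
    rcases stripWt_ne_zero (right_ne_zero_of_mul hF) hi with h | h
    · exact Or.inl h.symm
    · exact Or.inr (by simp [bit, h])
  · intro A hA hF
    have hint {i : ℕ} (hi : i < n + 1) :=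
      interlaces_of_branchWt_ne_zero (left_ne_zero_of_mul hF) hi
    refine ⟨fun i hi => ?_, (hint (Nat.succ_pos n)).2.trans (by simpa [rows] using hM)⟩
    refine le_trans ?_ (hint hi).1
    rcases Nat.lt_or_ge (i + 1) (n + 1) with hi' | hi'
    · exact (hint hi').2
    · have : i + 1 ∉ A := fun h => absurd (Finset.mem_range.1 (hA h)) (not_lt.2 hi')
      simp [this, bit, rows, rows_eq_zero hk hi']

lemma sum_inBox_stripWt_mul_branchWt {n M : ℕ} {lam kap : YoungDiagram} (t x : R)
    (hlam : lam ∈ inBox (n + 1) M) (hM : lam.rowLen 0 < M) :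
    ∑ nu ∈ inBox (n + 1) M, stripWt (n + 1) t nu.rows lam.rows *
        branchWt (n + 1) x nu.rows kap.rows =
      ∑ A ∈ (Finset.range (n + 1)).powerset,
        stripWt (n + 1) t (fun i => lam.rows i + bit (decide (i ∈ A))) lam.rows *
          branchWt (n + 1) x (fun i => lam.rows i + bit (decide (i ∈ A))) kap.rows := by
  have hl := (mem_inBox.1 hlam).1
  refine sum_inBox_eq_sum_powerset (d := bit)
    (F := fun f => stripWt (n + 1) t f lam.rows * branchWt (n + 1) x f kap.rows)
    (by simp [bit]) (by simp [bit]) (fun i hi => by simp [rows, rows_eq_zero hl hi]) ?_ ?_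
  · intro mu hF i hi
    exact stripWt_ne_zero (left_ne_zero_of_mul hF) hi
  · intro A hA hF
    refine ⟨fun i hi => ?_, ?_⟩
    · have := interlaces_of_branchWt_ne_zero (right_ne_zero_of_mul hF) hi
      exact this.1.trans this.2
    · simp only [bit, rows]
      split_ifs <;> omega

lemma map_branchWt {S : Type*} [CommRing S] (φ : R →+* S) (N : ℕ) (x : R) (a b : ℕ → ℤ) :
    φ (branchWt N x a b) = branchWt N (φ x) a b := by
  simp only [branchWt, rowWt, cornerWt, map_prod, map_mul, apply_ite φ, map_pow, map_zero,
    map_add, map_one]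

lemma stripWt_self (N : ℕ) (t : R) (lam : ℕ → ℤ) : stripWt N t lam lam = 1 := by
  simp [stripWt, boxWt]

/-- **Generating-function Pieri rule**: multiplication by `∏ (1 + (1 + t) x_i)` adds vertical
strips. -/
theorem prod_mul_svtSum {n m M : ℕ} (hm : m ≤ n) (φ : MvPolynomial ℕ ℤ →+* R) (t : R)
    {lam : YoungDiagram} (hlam : lam ∈ inBox (n + 1) M) (hM : lam.rowLen 0 < M) :
    (∏ i ∈ Finset.range m, (1 + (1 + t) * φ (X i))) * φ (svtSum m lam) =
      ∑ nu ∈ inBox (n + 1) M, stripWt (n + 1) t nu.rows lam.rows * φ (svtSum m nu) := by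
  classical
  induction m generalizing lam with
  | zero =>
    rw [Finset.sum_eq_single ⊥]
    · rw [svtSum_bot]
      by_cases h : lam = ⊥
      · simp [h, stripWt_self, svtSum_bot]
      · rw [svtSum_zero h]
        have : stripWt (n + 1) t (⊥ : YoungDiagram).rows lam.rows = 0 := by
          by_contra hne
          refine h (ext_rowLen fun i => ?_)
          rw [rowLen_bot]
          rcases Nat.lt_or_ge i (n + 1) with hi | hi
          · have := stripWt_ne_zero hne hi
            simp only [rows, rowLen_bot] at this
            omega
          · exact rows_eq_zero (mem_inBox.1 hlam).1 hi
        simp [this]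
    · intro nu _ hnu
      simp [svtSum_zero hnu]
    · intro h
      exact absurd (mem_inBox.2 (by simp [rowLen_bot])) h
  | succ m ih =>
    have hstep (kap : YoungDiagram) (hkap : kap ∈ inBox (n + 1) M) :
        (∑ nu ∈ inBox (n + 1) M, stripWt (n + 1) t nu.rows lam.rows *
          branchWt (n + 1) (φ (X m)) nu.rows kap.rows) * φ (svtSum m kap) =
        (1 + (1 + t) * φ (X m)) * (∑ mu ∈ inBox (n + 1) M,
          branchWt (n + 1) (φ (X m)) lam.rows mu.rows * stripWt (n + 1) t kap.rows mu.rows) *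
            φ (svtSum m kap) := by
      by_cases hn : kap.rowLen n = 0
      · rw [sum_inBox_stripWt_mul_branchWt t _ hlam hM,
          sum_inBox_branchWt_mul_stripWt t _ hlam hkap,
          sum_branch_strip_eq_sum_strip_branch n t _ lam.rows_antitone kap.rows_antitone
            (by simp [rows, (mem_inBox.1 hlam).1]) (by simp [rows, hn])]
      · rw [svtSum_eq_zero (i := n) (by omega) hn]
        simp
    have hrhs : ∑ nu ∈ inBox (n + 1) M,
          stripWt (n + 1) t nu.rows lam.rows * φ (svtSum (m + 1) nu) =
        ∑ kap ∈ inBox (n + 1) M, (∑ nu ∈ inBox (n + 1) M, stripWt (n + 1) t nu.rows lam.rows *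
          branchWt (n + 1) (φ (X m)) nu.rows kap.rows) * φ (svtSum m kap) := by
      simp only [Finset.sum_mul]
      rw [Finset.sum_comm]
      refine Finset.sum_congr rfl fun nu hnu => ?_
      rw [svtSum_succ hnu, map_sum, Finset.mul_sum]
      exact Finset.sum_congr rfl fun kap _ => by rw [map_mul, map_branchWt, mul_assoc]
    rw [hrhs, Finset.sum_congr rfl hstep, svtSum_succ hlam, map_sum, Finset.prod_range_succ]
    have hih : ∀ mu ∈ inBox (n + 1) M,
        branchWt (n + 1) (φ (X m)) lam.rows mu.rows *
          ((∏ i ∈ Finset.range m, (1 + (1 + t) * φ (X i))) * φ (svtSum m mu)) =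
        branchWt (n + 1) (φ (X m)) lam.rows mu.rows *
          ∑ kap ∈ inBox (n + 1) M, stripWt (n + 1) t kap.rows mu.rows * φ (svtSum m kap) := by
      intro mu hmu
      by_cases hb : branchWt (n + 1) (φ (X m)) lam.rows mu.rows = 0
      · rw [hb, zero_mul, zero_mul]
      · rw [ih (by omega) hmu]
        have := (interlaces_of_branchWt_ne_zero hb (Nat.succ_pos n)).2
        simp only [rows] at this
        omega
    calc _ = (1 + (1 + t) * φ (X m)) * ∑ mu ∈ inBox (n + 1) M,
          branchWt (n + 1) (φ (X m)) lam.rows mu.rows *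
          ((∏ i ∈ Finset.range m, (1 + (1 + t) * φ (X i))) * φ (svtSum m mu)) := by
          rw [Finset.mul_sum, Finset.mul_sum]
          refine Finset.sum_congr rfl fun mu _ => ?_
          rw [map_mul, map_branchWt]
          ring
      _ = _ := by
          rw [Finset.sum_congr rfl hih]
          simp only [Finset.mul_sum, Finset.sum_mul]
          rw [Finset.sum_comm]
          refine Finset.sum_congr rfl fun mu _ => Finset.sum_congr rfl fun nu _ => by ring

end Pieri

/-! ### Vertical strips -/

section Strip

variable {R : Type*} [CommRing R] {lam nu : YoungDiagram}

/-- The nonempty columns of `nu / lam`. -/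
def stripCols (lam nu : YoungDiagram) : Finset ℕ := (nu.cells \ lam.cells).image Prod.snd

open scoped Classical in
/-- The nonempty columns of `nu / lam` other than the rightmost one. -/
noncomputable def innerCols (lam nu : YoungDiagram) : Finset ℕ :=
  (stripCols lam nu).filter fun j => ∃ j' ∈ stripCols lam nu, j < j'

/-- The rows of `nu / lam`, when it is a vertical strip. -/
def stripRows (N : ℕ) (lam nu : YoungDiagram) : Finset ℕ :=
  (Finset.range N).filter fun i => nu.rowLen i = lam.rowLen i + 1

/-- The rows containing the top box of a column of `nu / lam`. -/
def topRows (N : ℕ) (lam nu : YoungDiagram) : Finset ℕ :=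
  (stripRows N lam nu).filter fun i => lam.rows i < rowAbove lam.rows i

lemma lt_rowAbove_iff {i : ℕ} :
    lam.rows i < rowAbove lam.rows i ↔ ∀ k < i, lam.rowLen i < lam.rowLen k := by
  cases i with
  | zero => simp [rowAbove]
  | succ i =>
    simp only [rowAbove, rows, Nat.cast_lt]
    refine ⟨fun h k hk => h.trans_le (lam.rowLen_anti k i (by omega)), fun h => h i (by omega)⟩

lemma mem_sdiff_cells {N : ℕ} (hN : nu.rowLen N = 0) (h : IsVerticalStrip lam nu) {i j : ℕ} :
    (i, j) ∈ nu.cells \ lam.cells ↔ i ∈ stripRows N lam nu ∧ lam.rowLen i = j := by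
  rw [Finset.mem_sdiff, mem_cells, mem_cells, mem_iff_lt_rowLen, mem_iff_lt_rowLen, stripRows,
    Finset.mem_filter, Finset.mem_range]
  have h1 := h i
  have h2 : N ≤ i → nu.rowLen i = 0 := rows_eq_zero hN
  rcases lt_or_ge i N with h3 | h3
  · omega
  · have := h2 h3
    omega

lemma card_stripRows {N : ℕ} (hN : nu.rowLen N = 0) (hle : lam ≤ nu)
    (h : IsVerticalStrip lam nu) : (stripRows N lam nu).card = nu.card - lam.card := by
  have h1 : (nu.cells \ lam.cells).card = nu.card - lam.card :=
    Finset.card_sdiff_of_subset (cells_subset_iff.2 hle)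
  rw [← h1]
  refine Finset.card_bij (fun i _ => (i, lam.rowLen i))
    (fun i hi => (mem_sdiff_cells hN h).2 ⟨hi, rfl⟩) (fun i _ k _ e => (Prod.mk.inj e).1) ?_
  rintro ⟨i, j⟩ hc
  obtain ⟨hi, rfl⟩ := (mem_sdiff_cells hN h).1 hc
  exact ⟨i, hi, rfl⟩

lemma mem_stripCols {N : ℕ} (hN : nu.rowLen N = 0) (h : IsVerticalStrip lam nu) {j : ℕ} :
    j ∈ stripCols lam nu ↔ ∃ i ∈ stripRows N lam nu, lam.rowLen i = j := by
  simp only [stripCols, Finset.mem_image, Prod.exists, exists_eq_right, mem_sdiff_cells hN h]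

lemma card_topRows {N : ℕ} (hN : nu.rowLen N = 0) (h : IsVerticalStrip lam nu) :
    (topRows N lam nu).card = (stripCols lam nu).card := by
  classical
  refine Finset.card_bij (fun i _ => lam.rowLen i)
    (fun i hi => (mem_stripCols hN h).2 ⟨i, (Finset.mem_filter.1 hi).1, rfl⟩) ?_ ?_
  · intro i hi k hk e
    have h1 := lt_rowAbove_iff.1 (Finset.mem_filter.1 hi).2 k
    have h2 := lt_rowAbove_iff.1 (Finset.mem_filter.1 hk).2 i
    by_contra hne
    rcases Nat.lt_or_gt_of_ne hne with hlt | hlt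
    · exact absurd (h2 hlt) (by omega)
    · exact absurd (h1 hlt) (by omega)
  · intro j hj
    obtain ⟨i, hi, hij⟩ := (mem_stripCols hN h).1 hj
    have hex : ∃ k, lam.rowLen k = j := ⟨i, hij⟩
    have hle : Nat.find hex ≤ i := Nat.find_min' hex hij
    have hfind := Nat.find_spec hex
    obtain ⟨hiN, hinu⟩ := Finset.mem_filter.1 hi
    refine ⟨Nat.find hex, Finset.mem_filter.2 ⟨Finset.mem_filter.2
      ⟨Finset.mem_range.2 (hle.trans_lt (Finset.mem_range.1 hiN)), ?_⟩,
      lt_rowAbove_iff.2 fun k hk => ?_⟩, hfind⟩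
    · have h1 := nu.rowLen_anti _ _ hle
      have h2 := h (Nat.find hex)
      omega
    · have h1 := Nat.find_min hex hk
      have h2 := lam.rowLen_anti _ _ hk.le
      omega

lemma card_innerCols (h : (stripCols lam nu).Nonempty) :
    (innerCols lam nu).card + 1 = (stripCols lam nu).card := by
  have : innerCols lam nu = (stripCols lam nu).erase ((stripCols lam nu).max' h) := by
    ext j
    simp only [innerCols, Finset.mem_filter, Finset.mem_erase]
    constructor
    · rintro ⟨hj, j', hj', hlt⟩
      exact ⟨(hlt.trans_le (Finset.le_max' _ _ hj')).ne, hj⟩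
    · rintro ⟨hne, hj⟩
      exact ⟨hj, _, Finset.max'_mem _ h, lt_of_le_of_ne (Finset.le_max' _ _ hj) hne⟩
  rw [this, Finset.card_erase_add_one (Finset.max'_mem _ h)]

lemma stripWt_eq_pow_mul_pow {N : ℕ} (t : R) (hle : lam ≤ nu) (h : IsVerticalStrip lam nu) :
    stripWt N t nu.rows lam.rows =
      (1 + t) ^ (topRows N lam nu).card *
        t ^ ((stripRows N lam nu).card - (topRows N lam nu).card) := by
  have h1 : ∀ i ∈ Finset.range N, boxWt t (rowAbove lam.rows i) (lam.rows i) (nu.rows i) =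
      if nu.rowLen i = lam.rowLen i + 1 then
        (if lam.rows i < rowAbove lam.rows i then 1 + t else t) else 1 := by
    intro i _
    have h2 := le_iff_rowLen_le.1 hle i
    have h3 := h i
    by_cases h4 : nu.rowLen i = lam.rowLen i + 1
    · have h5 : nu.rows i = lam.rows i + 1 := by simp [rows, h4]
      rw [if_pos h4, boxWt, if_pos h5, if_neg (by omega)]
    · have h5 : nu.rows i = lam.rows i := by simp only [rows]; omega
      rw [if_neg h4, boxWt, if_pos h5]
  rw [stripWt, Finset.prod_congr rfl h1, ← Finset.prod_filter, Finset.prod_ite,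
    Finset.prod_const, Finset.prod_const]
  congr 2
  have := Finset.card_filter_add_card_filter_not (s := stripRows N lam nu)
    (fun i => lam.rows i < rowAbove lam.rows i)
  simp only [topRows, stripRows] at this ⊢
  omega

lemma stripRows_nonempty {N : ℕ} (hN : nu.rowLen N = 0) (hle : lam ≤ nu)
    (h : IsVerticalStrip lam nu) (hne : nu ≠ lam) : (stripRows N lam nu).Nonempty := by
  by_contra hcon
  refine hne (ext_rowLen fun i => ?_)
  have h1 := le_iff_rowLen_le.1 hle i
  have h2 := h i
  by_contra hi
  refine hcon ⟨i, Finset.mem_filter.2 ⟨Finset.mem_range.2 ?_, by omega⟩⟩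
  by_contra! h3
  have := rows_eq_zero hN h3
  omega

open scoped Classical in
/-- The vertical strip weight of a nontrivial strip, divided by `1 + t`. -/
noncomputable def stripQuot (t : R) (lam nu : YoungDiagram) : R :=
  if lam ≤ nu ∧ IsVerticalStrip lam nu ∧ nu ≠ lam then
    ∑ S ∈ (innerCols lam nu).powerset, t ^ (nu.card - lam.card - 1 - S.card) else 0

lemma card_innerCols_lt {N : ℕ} (hN : nu.rowLen N = 0) (hle : lam ≤ nu)
    (h : IsVerticalStrip lam nu) (hne : nu ≠ lam) :
    (innerCols lam nu).card < nu.card - lam.card ∧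
      (topRows N lam nu).card = (innerCols lam nu).card + 1 := by
  obtain ⟨i, hi⟩ := stripRows_nonempty hN hle h hne
  have h1 := card_innerCols ⟨_, (mem_stripCols hN h).2 ⟨i, hi, rfl⟩⟩
  have h2 := card_topRows hN h
  have h3 := card_stripRows hN hle h
  have h4 : (topRows N lam nu).card ≤ (stripRows N lam nu).card :=
    Finset.card_le_card (Finset.filter_subset _ _)
  omega

lemma stripWt_eq_add {N : ℕ} (t : R) (hlam : lam.rowLen N = 0) (hnu : nu.rowLen N = 0)
    [Decidable (nu = lam)] :
    stripWt N t nu.rows lam.rows = (if nu = lam then 1 else 0) + (1 + t) * stripQuot t lam nu := by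
  by_cases hne : nu = lam
  · subst hne
    simp [stripWt_self, stripQuot]
  rw [if_neg hne, zero_add, stripQuot]
  split_ifs with h
  · obtain ⟨hle, hs, -⟩ := h
    obtain ⟨h1, h2⟩ := card_innerCols_lt hnu hle hs hne
    rw [stripWt_eq_pow_mul_pow t hle hs, h2, card_stripRows hnu hle hs, pow_succ', mul_assoc,
      ← Finset.sum_pow_mul_eq_add_pow, Finset.sum_mul]
    congr 1
    refine Finset.sum_congr rfl fun S hS => ?_
    have := Finset.card_le_card (Finset.mem_powerset.1 hS)
    rw [one_pow, one_mul, ← pow_add]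
    congr 1
    omega
  · rw [mul_zero]
    by_contra hcon
    have hrow (i : ℕ) : nu.rowLen i = lam.rowLen i ∨ nu.rowLen i = lam.rowLen i + 1 := by
      rcases lt_or_ge i N with hi | hi
      · have := stripWt_ne_zero hcon hi
        simp only [rows] at this
        omega
      · left
        rw [rows_eq_zero hlam hi, rows_eq_zero hnu hi]
    refine h ⟨le_iff_rowLen_le.2 fun i => ?_, fun i => ?_, hne⟩
    all_goals
      have := hrow i
      omega

open scoped Classical in
/-- The admissible sets of columns for the shape `nu`. -/
noncomputable def stripSets (l : ℕ) (lam nu : YoungDiagram) : Finset (Finset ℕ) :=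
  if lam ≤ nu ∧ IsVerticalStrip lam nu then
    (innerCols lam nu).powerset.filter fun S => S.card + l = nu.card - lam.card else ∅

lemma mem_stripSets {l : ℕ} {S : Finset ℕ} :
    S ∈ stripSets l lam nu ↔ lam ≤ nu ∧ IsVerticalStrip lam nu ∧ l ≤ nu.card - lam.card ∧
      S ⊆ stripCols lam nu ∧ (∀ j ∈ S, ∃ j' ∈ stripCols lam nu, j < j') ∧
      S.card = nu.card - lam.card - l := by
  rw [stripSets]
  split_ifs with h
  · simp only [Finset.mem_filter, Finset.mem_powerset, innerCols, Finset.subset_iff]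
    refine ⟨fun ⟨h1, h2⟩ => ⟨h.1, h.2, by omega, fun j hj => (h1 hj).1, fun j hj => (h1 hj).2,
      by omega⟩, fun ⟨_, _, h3, h4, h5, h6⟩ => ⟨fun j hj => ⟨h4 hj, h5 j hj⟩, by omega⟩⟩
  · exact ⟨fun hS => absurd hS (Finset.notMem_empty S), fun hS => absurd ⟨hS.1, hS.2.1⟩ h⟩

lemma coeff_stripQuot {A : Type*} [CommRing A] {N l : ℕ} (hnu : nu.rowLen N = 0) (hl : 1 ≤ l) :
    (stripQuot (Polynomial.X : Polynomial A) lam nu).coeff (l - 1) =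
      ((stripSets l lam nu).card : A) := by
  rw [stripQuot, stripSets]
  by_cases hne : nu = lam
  · subst hne
    rw [if_neg (by simp)]
    split_ifs
    · rw [Finset.filter_false_of_mem fun S _ => by omega]
      simp
    · simp
  by_cases h : lam ≤ nu ∧ IsVerticalStrip lam nu
  · rw [if_pos ⟨h.1, h.2, hne⟩, if_pos h, Polynomial.finsetSum_coeff, Finset.card_filter,
      Nat.cast_sum]
    refine Finset.sum_congr rfl fun S hS => ?_
    have h1 := (card_innerCols_lt hnu h.1 h.2 hne).1
    have h2 := Finset.card_le_card (Finset.mem_powerset.1 hS)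
    rw [Polynomial.coeff_X_pow]
    have : (l - 1 = nu.card - lam.card - 1 - S.card) ↔ (S.card + l = nu.card - lam.card) := by
      omega
    simp [this]
  · rw [if_neg fun hh => h ⟨hh.1, hh.2.1⟩, if_neg h]
    simp

lemma rect_rowLen {p q i : ℕ} (hi : i < p) : (rect p q).rowLen i = q := by
  refine eq_of_forall_lt_iff fun j => ?_
  rw [← mem_iff_lt_rowLen, ← mem_cells]
  simp [rect, hi]

lemma rect_rowLen_of_le {p q i : ℕ} (hi : p ≤ i) : (rect p q).rowLen i = 0 := by
  by_contra h
  have h1 : (i, 0) ∈ (rect p q).cells :=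
    (mem_cells _).2 (mem_iff_lt_rowLen.2 (Nat.pos_of_ne_zero h))
  simp [rect] at h1
  omega

lemma stripCols_bot_subset (h : IsVerticalStrip ⊥ nu) : stripCols ⊥ nu ⊆ {0} := by
  intro j hj
  obtain ⟨⟨i, k⟩, hc, rfl⟩ := Finset.mem_image.1 hj
  have h1 := mem_iff_lt_rowLen.1 ((mem_cells _).1 (Finset.mem_sdiff.1 hc).1)
  have h2 := h i
  rw [rowLen_bot] at h2
  simp only [Finset.mem_singleton]
  omega

lemma eq_rect_of_isVerticalStrip_bot (h : IsVerticalStrip ⊥ nu) : nu = rect nu.card 1 := by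
  have key : nu = rect (nu.colLen 0) 1 := by
    refine YoungDiagram.ext (Finset.ext fun ⟨i, j⟩ => ?_)
    simp only [rect, Finset.mem_product, Finset.mem_range, Nat.lt_one_iff]
    rw [mem_cells]
    constructor
    · intro hc
      have h1 := mem_iff_lt_rowLen.1 hc
      have h2 := h i
      rw [rowLen_bot] at h2
      obtain rfl : j = 0 := by omega
      exact ⟨mem_iff_lt_colLen.1 hc, rfl⟩
    · rintro ⟨hi, rfl⟩
      exact mem_iff_lt_colLen.2 hi
  have hcard : nu.card = nu.colLen 0 := by
    conv_lhs => rw [key]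
    simp [YoungDiagram.card, rect]
  rw [hcard]
  exact key

lemma card_stripSets_bot {l : ℕ} [Decidable (nu = rect l 1)] :
    (stripSets l ⊥ nu).card = if nu = rect l 1 then 1 else 0 := by
  split_ifs with h
  · have hs : IsVerticalStrip ⊥ nu := fun i => by
      rw [h, rowLen_bot]
      rcases lt_or_ge i l with hi | hi
      · rw [rect_rowLen hi]
      · simp [rect_rowLen_of_le hi]
    have hc : nu.card = l := by simp [h, YoungDiagram.card, rect]
    rw [Finset.card_eq_one]
    refine ⟨∅, Finset.ext fun S => ?_⟩
    rw [mem_stripSets, Finset.mem_singleton]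
    have hb : (⊥ : YoungDiagram).card = 0 := by simp [YoungDiagram.card]
    constructor
    · rintro ⟨-, -, -, -, -, h6⟩
      rw [← Finset.card_eq_zero]
      omega
    · rintro rfl
      refine ⟨bot_le, hs, by omega, Finset.empty_subset _, by simp, by simp; omega⟩
  · rw [Finset.card_eq_zero, Finset.eq_empty_iff_forall_notMem]
    intro S hS
    obtain ⟨-, hs, h3, h4, h5, h6⟩ := mem_stripSets.1 hS
    have hS0 : S = ∅ := by
      refine Finset.eq_empty_iff_forall_notMem.2 fun j hj => ?_
      obtain ⟨j', hj', hlt⟩ := h5 j hj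
      have := Finset.mem_singleton.1 (stripCols_bot_subset hs hj')
      omega
    have hb : (⊥ : YoungDiagram).card = 0 := by simp [YoungDiagram.card]
    rw [hS0, Finset.card_empty] at h6
    have hc : nu.card = l := by omega
    exact h (hc ▸ eq_rect_of_isVerticalStrip_bot hs)

/-- **Pieri rule** for the weight generating functions of set-valued tableaux. -/
theorem svtSum_rect_mul_svtSum {m n l M : ℕ} (hm : m ≤ n) (hl : 1 ≤ l) (hln : l ≤ n)
    (hlam : lam ∈ inBox (n + 1) M) (hM : lam.rowLen 0 < M) :
    svtSum m (rect l 1) * svtSum m lam =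
      ∑ nu ∈ inBox (n + 1) M, (stripSets l lam nu).card • svtSum m nu := by
  classical
  let F : Polynomial (MvPolynomial ℕ ℤ) :=
    ∏ i ∈ Finset.range m, (1 + (1 + Polynomial.X) * Polynomial.C (X i))
  let H (mu : YoungDiagram) : Polynomial (MvPolynomial ℕ ℤ) :=
    ∑ nu ∈ inBox (n + 1) M, stripQuot Polynomial.X mu nu * Polynomial.C (svtSum m nu)
  have hF (mu : YoungDiagram) (hmu : mu ∈ inBox (n + 1) M) (hmu' : mu.rowLen 0 < M) :
      F * Polynomial.C (svtSum m mu) =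
        Polynomial.C (svtSum m mu) + (1 + Polynomial.X) * H mu := by
    have h := prod_mul_svtSum hm (Polynomial.C : MvPolynomial ℕ ℤ →+* _) Polynomial.X hmu hmu'
    rw [show F * _ = _ from h, Finset.mul_sum, Finset.sum_congr rfl fun nu hnu => by
      rw [stripWt_eq_add _ (mem_inBox.1 hmu).1 (mem_inBox.1 hnu).1, add_mul, mul_assoc],
      Finset.sum_add_distrib]
    simp [hmu]
  have hcoeff (mu : YoungDiagram) : (H mu).coeff (l - 1) =
      ∑ nu ∈ inBox (n + 1) M, (stripSets l mu nu).card • svtSum m nu := by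
    rw [Polynomial.finsetSum_coeff]
    refine Finset.sum_congr rfl fun nu hnu => ?_
    rw [Polynomial.coeff_mul_C, coeff_stripQuot (mem_inBox.1 hnu).1 hl, nsmul_eq_mul]
  have hbot := hF ⊥ (mem_inBox.2 (by simp [rowLen_bot])) (by rw [rowLen_bot]; omega)
  have hlam' := hF lam hlam hM
  rw [svtSum_bot, Polynomial.C_1, mul_one] at hbot
  have hne : (1 + Polynomial.X : Polynomial (MvPolynomial ℕ ℤ)) ≠ 0 := by
    rw [add_comm, ← Polynomial.C_1]
    exact Polynomial.X_add_C_ne_zero 1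
  have hH : H ⊥ * Polynomial.C (svtSum m lam) = H lam := by
    refine mul_left_cancel₀ hne ?_
    rw [hbot] at hlam'
    linear_combination hlam'
  rw [← hcoeff, ← hH, Polynomial.coeff_mul_C, hcoeff, Finset.sum_congr rfl fun nu _ => by
    rw [card_stripSets_bot, ite_smul, one_smul, zero_smul], Finset.sum_ite_eq', if_pos]
  exact mem_inBox.2 ⟨rect_rowLen_of_le (by omega), by rw [rect_rowLen (by omega)]; omega⟩

end Strip

/-! ### From generating functions to bijections -/

/-- The exponent vector of the monomial of `T`. -/
noncomputable def SVT.exponent {cells : Finset (ℕ × ℕ)} (T : SVT cells) : ℕ →₀ ℕ :=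
  ∑ c ∈ cells, ∑ i ∈ T.entry c, Finsupp.single i 1

lemma SVT.monomial_eq {cells : Finset (ℕ × ℕ)} (T : SVT cells) :
    T.monomial = MvPolynomial.monomial T.exponent 1 := by
  simp only [SVT.monomial, SVT.exponent, MvPolynomial.monomial_sum_one, MvPolynomial.X]

lemma monomial_add_one (a b : ℕ →₀ ℕ) : MvPolynomial.monomial (a + b) (1 : ℤ) =
    MvPolynomial.monomial a 1 * MvPolynomial.monomial b 1 := by
  rw [MvPolynomial.monomial_mul, one_mul]

lemma exists_equiv_of_sum_monomial_eq {α β σ : Type*} [Fintype α] [Fintype β]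
    (e : α → σ →₀ ℕ) (e' : β → σ →₀ ℕ)
    (h : ∑ a, MvPolynomial.monomial (e a) (1 : ℤ) = ∑ b, MvPolynomial.monomial (e' b) (1 : ℤ)) :
    ∃ f : α ≃ β, ∀ a, e a = e' (f a) := by
  classical
  have hcard (s : σ →₀ ℕ) : Nonempty ({a // e a = s} ≃ {b // e' b = s}) := by
    have := congrArg (MvPolynomial.coeff s) h
    simp only [MvPolynomial.coeff_sum, MvPolynomial.coeff_monomial, Finset.sum_boole,
      Nat.cast_inj] at this
    rw [← Fintype.card_eq, Fintype.card_subtype, Fintype.card_subtype, this]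
  let g (s : σ →₀ ℕ) := (hcard s).some
  refine ⟨(Equiv.sigmaFiberEquiv e).symm.trans
    ((Equiv.sigmaCongrRight g).trans (Equiv.sigmaFiberEquiv e')), fun a => ?_⟩
  exact (g (e a) ⟨a, rfl⟩).2.symm

/-- **The column bumping bijection** (Theorem 4.2): for `m, ℓ ≥ 1` and a
partition `λ`, there is a bijection between pairs `(C, T)` of set-valued
tableaux with entries in `{1,…,m}` of shapes `(1^ℓ)` and `λ`, and pairs
`(T', S)` where `T'` is a set-valued tableau with entries in `{1,…,m}` whose
shape is a partition `ν ⊇ λ` with `ν/λ` a vertical strip, `|ν/λ| ≥ ℓ`, and `S`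
is a set of indices of nonempty columns of `ν/λ` avoiding the rightmost
nonempty column, with `#S = |ν/λ| - ℓ`; moreover `x^C · x^T = x^{T'}`. -/
theorem column_bumping_bijection (m l : ℕ) (hm : 1 ≤ m) (hl : 1 ≤ l) (lam : YoungDiagram) :
    ∃ f : {p : SVT (rect l 1).cells × SVT lam.cells // p.1.Bounded m ∧ p.2.Bounded m} ≃
        {q : Σ nu : YoungDiagram, SVT nu.cells × Finset ℕ //
          lam ≤ q.1 ∧ IsVerticalStrip lam q.1 ∧ l ≤ q.1.card - lam.card ∧
          q.2.1.Bounded m ∧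
          q.2.2 ⊆ (q.1.cells \ lam.cells).image Prod.snd ∧
          (∀ j ∈ q.2.2, ∃ j' ∈ (q.1.cells \ lam.cells).image Prod.snd, j < j') ∧
          q.2.2.card = q.1.card - lam.card - l},
      ∀ p, p.1.1.monomial * p.1.2.monomial = ((f p).1.2.1).monomial := by
  have hlam : lam ∈ inBox (lam.colLen 0 + m + l + 1) (lam.rowLen 0 + 1) := by
    refine mem_inBox.2 ⟨?_, by omega⟩
    by_contra h
    have := mem_iff_lt_colLen.1 (mem_iff_lt_rowLen.2 (Nat.pos_of_ne_zero h))
    omega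
  have hsum := svtSum_rect_mul_svtSum (m := m) (by omega) hl (by omega) hlam (by omega)
  obtain ⟨f, hf⟩ := exists_equiv_of_sum_monomial_eq
    (fun p : {T : SVT (rect l 1).cells // T.Bounded m} × {T : SVT lam.cells // T.Bounded m} =>
      p.1.1.exponent + p.2.1.exponent)
    (fun q : Σ nu : inBox (lam.colLen 0 + m + l + 1) (lam.rowLen 0 + 1),
      {T : SVT nu.1.cells // T.Bounded m} × stripSets l lam nu.1 => q.2.1.1.exponent) (by
    rw [Fintype.sum_prod_type, Fintype.sum_sigma]
    simp only [Fintype.sum_prod_type, monomial_add_one, ← SVT.monomial_eq, Finset.sum_const,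
      Finset.card_univ, Fintype.card_coe, ← Finset.smul_sum]
    rw [← Finset.sum_mul_sum]
    rw [Finset.sum_coe_sort (inBox (lam.colLen 0 + m + l + 1) (lam.rowLen 0 + 1))
      fun nu => (stripSets l lam nu).card • ∑ T : {T : SVT nu.cells // T.Bounded m}, T.1.monomial]
    exact hsum)
  refine ⟨(Equiv.subtypeProdEquivProd.trans f).trans
    { toFun := fun q => ⟨⟨q.1.1, q.2.1.1, q.2.2.1⟩, ?_⟩
      invFun := fun q => ⟨⟨q.1.1, ?_⟩, ⟨q.1.2.1, ?_⟩, ⟨q.1.2.2, ?_⟩⟩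
      left_inv := fun _ => rfl
      right_inv := fun _ => rfl }, fun p => ?_⟩
  · obtain ⟨h1, h2, h3, h4, h5, h6⟩ := mem_stripSets.1 q.2.2.2
    exact ⟨h1, h2, h3, q.2.1.2, h4, h5, h6⟩
  · obtain ⟨-, h2, -, h4, -⟩ := q.2
    exact mem_inBox.2 ⟨h4.rowLen_eq_zero (by omega), h2 0⟩
  · exact q.2.2.2.2.1
  · obtain ⟨h1, h2, h3, -, h4, h5, h6⟩ := q.2
    exact mem_stripSets.2 ⟨h1, h2, h3, h4, h5, h6⟩
  · have := hf (Equiv.subtypeProdEquivProd p)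
    simp only [SVT.monomial_eq, ← monomial_add_one]
    exact congrArg (fun s => MvPolynomial.monomial s 1) this
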